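/- Let (R, m) be a Noetherian local ring, I and J ideals, a ∈ I, b ∈ J. If a, b form a joint reduction of I, J (i.e., aJ + Ib is a reduction of IJ) and moreover IJ = aJ + Ib holds after multiplying by some power, then in a two-dimensional regular local ring with I and J both m-primary and integrally closed, one has IJ = aJ + Ib exactly. -/

import Mathlib

open IsLocalRing

/-- An ideal `I` of a commutative ring is integrally closed if every element `x`
satisfying an equation of integral dependence `x^n + c₁ x^{n-1} + ⋯ + cₙ = 0`
with `cᵢ ∈ I^i` already lies in `I`. -/
def Ideal.IsIntegrallyClosedIdeal {R : Type*} [CommRing R] (I : Ideal R) : Prop :=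
  ∀ x : R, (∃ n : ℕ, 0 < n ∧ ∃ c : ℕ → R, (∀ i, 1 ≤ i → i ≤ n → c i ∈ I ^ i) ∧
      x ^ n + ∑ i ∈ Finset.Icc 1 n, c i * x ^ (n - i) = 0) → x ∈ I

namespace Verma

section basic
variable {K : Type*} [Field K]

/-- `z` lies in the `V`-module generated by `I`. -/
def Cov (V : ValuationSubring K) (I : Set K) (z : K) : Prop := ∃ i ∈ I, ∃ w ∈ V, z = i * w

lemma Cov.add {V : ValuationSubring K} {I : Set K} {z w : K} (hz : Cov V I z) (hw : Cov V I w) :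
    Cov V I (z + w) := by
  obtain ⟨i, hi, u, hu, rfl⟩ := hz
  obtain ⟨j, hj, v, hv, rfl⟩ := hw
  by_cases hi0 : i = 0
  · subst hi0; exact ⟨j, hj, v, hv, by simp⟩
  by_cases hj0 : j = 0
  · subst hj0; exact ⟨i, hi, u, hu, by simp⟩
  rcases V.mem_or_inv_mem (j / i) with h | h
  · exact ⟨i, hi, u + j / i * v, V.add_mem _ _ hu (V.mul_mem _ _ h hv), by field_simp⟩
  · rw [inv_div] at h
    exact ⟨j, hj, i / j * u + v, V.add_mem _ _ (V.mul_mem _ _ h hu) hv, by field_simp⟩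

lemma Cov.mul {V : ValuationSubring K} {I : Set K} {z w : K} (hz : Cov V I z) (hw : w ∈ V) :
    Cov V I (w * z) := by
  obtain ⟨i, hi, u, hu, rfl⟩ := hz
  exact ⟨i, hi, w * u, V.mul_mem _ _ hw hu, by ring⟩

lemma Cov.sub {V : ValuationSubring K} {I : Set K} {z w : K} (hz : Cov V I z) (hw : Cov V I w) :
    Cov V I (z - w) := by
  have := hz.add (hw.mul (w := -1) (V.neg_mem _ V.one_mem))
  rwa [neg_one_mul, ← sub_eq_add_neg] at this

lemma exists_val_prime (S : Subring K) (P : Ideal S) [P.IsPrime] :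
    ∃ V : ValuationSubring K, S ≤ V.toSubring ∧ ∀ s : S, (s ∈ P → V.valuation (s : K) < 1) ∧
      (s ∉ P → V.valuation (s : K) = 1) := by
  obtain ⟨V, hV, hloc⟩ := (LocalSubring.ofPrime S P).exists_le_valuationSubring
  have hSV : S ≤ V.toSubring := (LocalSubring.le_ofPrime S P).trans hV
  refine ⟨V, hSV, fun s => ⟨fun hs => ?_, fun hs => ?_⟩⟩
  · rw [← ValuationSubring.mem_nonunits_iff, ValuationSubring.mem_nonunits_iff_exists_mem_maximalIdeal]
    refine ⟨hSV s.2, ?_⟩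
    rw [IsLocalRing.mem_maximalIdeal, mem_nonunits_iff]
    intro hu
    have h1 : IsUnit (Subring.inclusion hV (algebraMap S (LocalSubring.ofPrime S P).toSubring s)) := hu
    have h2 := hloc.map_nonunit _ h1
    rw [IsLocalization.AtPrime.isUnit_to_map_iff _ P] at h2
    exact h2 hs
  · have h2 : IsUnit (algebraMap S (LocalSubring.ofPrime S P).toSubring s) := by
      rw [IsLocalization.AtPrime.isUnit_to_map_iff _ P]; exact hs
    have h3 := h2.map (Subring.inclusion hV)
    exact (V.valuation_eq_one_iff ⟨s, hSV s.2⟩).1 h3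

lemma loc (A B : Subring K) (M : Submonoid K) (hM : ∀ s ∈ M, s ∈ A) (h0 : (0 : K) ∉ M)
    (hB : ∀ b ∈ B, ∃ s ∈ M, s * b ∈ A) (J : Set K) (hJ : J.Nonempty) (q : K)
    (hq : ∀ V : ValuationSubring K, B ≤ V.toSubring → Cov V J q) :
    ∃ s ∈ M, ∀ V : ValuationSubring K, A ≤ V.toSubring → Cov V J (s * q) := by
  by_cases hq0 : q = 0
  · subst hq0
    obtain ⟨j, hj⟩ := hJ
    exact ⟨1, M.one_mem, fun V _ => ⟨j, hj, 0, V.zero_mem, by simp⟩⟩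
  set G : Set K := {e | ∃ j ∈ J, e = j / q} with hG
  set B' : Subring K := Subring.closure (B ∪ G) with hB'
  set A' : Subring K := Subring.closure (A ∪ G) with hA'
  have hAA' : A ≤ A' := fun a ha => Subring.subset_closure (Or.inl ha)
  have hGA' : G ⊆ A' := fun a ha => Subring.subset_closure (Or.inr ha)
  have hloc : ∀ b ∈ B', ∃ s ∈ M, s * b ∈ A' := by
    intro b hb
    induction hb using Subring.closure_induction with
    | mem x hx =>
      rcases hx with hx | hx
      · obtain ⟨s, hs, h⟩ := hB x hx
        exact ⟨s, hs, hAA' h⟩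
      · exact ⟨1, M.one_mem, by rw [one_mul]; exact hGA' hx⟩
    | zero => exact ⟨1, M.one_mem, by simp⟩
    | one => exact ⟨1, M.one_mem, by simp⟩
    | add x y _ _ hx hy =>
      obtain ⟨s, hs, h⟩ := hx
      obtain ⟨s', hs', h'⟩ := hy
      refine ⟨s * s', M.mul_mem hs hs', ?_⟩
      have : s * s' * (x + y) = s' * (s * x) + s * (s' * y) := by ring
      rw [this]
      exact A'.add_mem (A'.mul_mem (hAA' (hM _ hs')) h) (A'.mul_mem (hAA' (hM _ hs)) h')
    | neg x _ hx =>
      obtain ⟨s, hs, h⟩ := hx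
      exact ⟨s, hs, by rw [mul_neg]; exact A'.neg_mem h⟩
    | mul x y _ _ hx hy =>
      obtain ⟨s, hs, h⟩ := hx
      obtain ⟨s', hs', h'⟩ := hy
      refine ⟨s * s', M.mul_mem hs hs', ?_⟩
      have : s * s' * (x * y) = (s * x) * (s' * y) := by ring
      rw [this]
      exact A'.mul_mem h h'
  have htop : Ideal.span {b : B' | (b : K) ∈ G} = ⊤ := by
    by_contra hne
    obtain ⟨V, hV, hn⟩ := Ideal.image_subset_nonunits_valuationSubring _ hne
    obtain ⟨j, hj, w, hw, e⟩ := hq V (fun b hb => hV (Subring.subset_closure (Or.inl hb)))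
    have hjG : j / q ∈ G := ⟨j, hj, rfl⟩
    have h1 : j / q ∈ V.nonunits :=
      hn ⟨⟨j / q, Subring.subset_closure (Or.inr hjG)⟩, Ideal.subset_span hjG, rfl⟩
    rw [ValuationSubring.mem_nonunits_iff] at h1
    have h2 : V.valuation (j / q * w) = 1 := by
      have : j / q * w = 1 := by rw [div_mul_eq_mul_div, ← e, div_self hq0]
      rw [this, map_one]
    rw [map_mul] at h2
    have h3 : V.valuation w ≤ 1 := (V.valuation_le_one_iff w).2 hw
    have := mul_lt_one_of_lt_of_le h1 h3
    exact this.ne h2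
  have key : ∀ e ∈ Ideal.span {b : B' | (b : K) ∈ G},
      ∃ s ∈ M, s * (e : K) ∈ Submodule.span A' G := by
    intro e he
    induction he using Submodule.span_induction with
    | mem x hx => exact ⟨1, M.one_mem, by rw [one_mul]; exact Submodule.subset_span hx⟩
    | zero => exact ⟨1, M.one_mem, by simp⟩
    | add x y _ _ hx hy =>
      obtain ⟨s, hs, h⟩ := hx
      obtain ⟨s', hs', h'⟩ := hy
      refine ⟨s * s', M.mul_mem hs hs', ?_⟩
      have : s * s' * ((x + y : B') : K) = (⟨s', hAA' (hM _ hs')⟩ : A') • (s * (x : K))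
          + (⟨s, hAA' (hM _ hs)⟩ : A') • (s' * (y : K)) := by
        simp only [Subring.smul_def, smul_eq_mul, Subring.coe_add]; ring
      rw [this]
      exact Submodule.add_mem _ (Submodule.smul_mem _ _ h) (Submodule.smul_mem _ _ h')
    | smul c x _ hx =>
      obtain ⟨s, hs, h⟩ := hx
      obtain ⟨s', hs', h'⟩ := hloc c c.2
      refine ⟨s * s', M.mul_mem hs hs', ?_⟩
      have : s * s' * ((c • x : B') : K) = (⟨_, h'⟩ : A') • (s * (x : K)) := by
        simp only [Subring.smul_def, smul_eq_mul, Subring.coe_mul]; ring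
      rw [this]
      exact Submodule.smul_mem _ _ h
  obtain ⟨s, hs, h⟩ := key 1 (htop ▸ Submodule.mem_top)
  rw [Subring.coe_one, mul_one] at h
  refine ⟨s, hs, fun V hV => ?_⟩
  by_contra hc
  have hs0 : s ≠ 0 := fun h => h0 (h ▸ hs)
  have hlt : ∀ e ∈ G, V.valuation e < V.valuation s := by
    rintro _ ⟨j, hj, rfl⟩
    by_contra hle
    rw [not_lt] at hle
    apply hc
    by_cases hj0 : j = 0
    · simp [hj0, hs0] at hle
    · refine ⟨j, hj, s * q / j, ?_, by field_simp⟩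
      rw [← V.valuation_le_one_iff]
      have : s * q / j = s * (j / q)⁻¹ := by field_simp
      rw [this, map_mul, map_inv₀]
      exact mul_inv_le_one_of_le₀ hle zero_le
  have hA'V : A' ≤ V.toSubring := by
    rw [hA', Subring.closure_le]
    rintro e (he | he)
    · exact hV he
    · exact (V.valuation_le_one_iff e).1
        ((hlt e he).le.trans ((V.valuation_le_one_iff s).2 (hV (hM s hs))))
  have : ∀ e ∈ Submodule.span A' G, V.valuation e < V.valuation s := by
    intro e he
    induction he using Submodule.span_induction with
    | mem x hx => exact hlt x hx
    | zero => simpa [zero_lt_iff] using hs0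
    | add x y _ _ hx hy => exact V.valuation.map_add_lt hx hy
    | smul c x _ hx =>
      rw [Subring.smul_def, smul_eq_mul, map_mul]
      exact (mul_le_of_le_one_left' ((V.valuation_le_one_iff _).2 (hA'V c.2))).trans_lt hx
  exact lt_irrefl _ (this s h)

/-- `A` is the intersection of the valuation rings containing it. -/
def Norm (A : Subring K) : Prop :=
  ∀ z : K, (∀ V : ValuationSubring K, A ≤ V.toSubring → z ∈ V) → z ∈ A

lemma norm_loc_mem (A B : Subring K) (M : Submonoid K) (hM : ∀ s ∈ M, s ∈ A) (h0 : (0 : K) ∉ M)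
    (hB : ∀ b ∈ B, ∃ s ∈ M, s * b ∈ A) (hA : Norm A) (z : K)
    (hz : ∀ V : ValuationSubring K, B ≤ V.toSubring → z ∈ V) : ∃ s ∈ M, s * z ∈ A := by
  obtain ⟨s, hs, h⟩ := loc A B M hM h0 hB {1} ⟨1, rfl⟩ z
    (fun V hV => ⟨1, rfl, z, hz V hV, by simp⟩)
  refine ⟨s, hs, hA _ fun V hV => ?_⟩
  obtain ⟨i, hi, w, hw, e⟩ := h V hV
  rw [Set.mem_singleton_iff] at hi
  rw [e, hi, one_mul]; exact hw

/-- The subring of elements `z` with `s ^ n * z ∈ A` for some `n`. -/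
def powLoc (A : Subring K) (s : K) (hs : s ∈ A) : Subring K where
  carrier := {z | ∃ n : ℕ, s ^ n * z ∈ A}
  zero_mem' := ⟨0, by simp⟩
  one_mem' := ⟨0, by simp⟩
  add_mem' := by
    rintro x y ⟨n, hn⟩ ⟨m, hm⟩
    refine ⟨n + m, ?_⟩
    have : s ^ (n + m) * (x + y) = s ^ m * (s ^ n * x) + s ^ n * (s ^ m * y) := by ring
    rw [this]
    exact A.add_mem (A.mul_mem (A.pow_mem hs _) hn) (A.mul_mem (A.pow_mem hs _) hm)
  neg_mem' := by
    rintro x ⟨n, hn⟩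
    exact ⟨n, by rw [mul_neg]; exact A.neg_mem hn⟩
  mul_mem' := by
    rintro x y ⟨n, hn⟩ ⟨m, hm⟩
    refine ⟨n + m, ?_⟩
    have : s ^ (n + m) * (x * y) = (s ^ n * x) * (s ^ m * y) := by ring
    rw [this]
    exact A.mul_mem hn hm

lemma le_powLoc (A : Subring K) (s : K) (hs : s ∈ A) : A ≤ powLoc A s hs :=
  fun a ha => ⟨0, by simpa using ha⟩

lemma norm_powLoc (A : Subring K) (s : K) (hs : s ∈ A) (hs0 : s ≠ 0) (hA : Norm A) (z : K)
    (hz : ∀ V : ValuationSubring K, powLoc A s hs ≤ V.toSubring → z ∈ V) :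
    ∃ n : ℕ, s ^ n * z ∈ A := by
  obtain ⟨m, ⟨n, rfl⟩, h⟩ := norm_loc_mem A (powLoc A s hs) (Submonoid.powers s)
    (by rintro _ ⟨n, rfl⟩; exact A.pow_mem hs n)
    (by rintro ⟨n, h⟩; exact pow_ne_zero n hs0 h)
    (by rintro b ⟨n, hn⟩; exact ⟨_, ⟨n, rfl⟩, hn⟩) hA z hz
  exact ⟨n, h⟩

lemma mem_ofPrime (S : Subring K) (P : Ideal S) [P.IsPrime] (z : K) :
    z ∈ (LocalSubring.ofPrime S P).toSubring ↔ ∃ s : S, s ∉ P ∧ (s : K) * z ∈ S := by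
  constructor
  · intro hz
    obtain ⟨⟨r, s⟩, h⟩ := IsLocalization.surj P.primeCompl
      (⟨z, hz⟩ : (LocalSubring.ofPrime S P).toSubring)
    refine ⟨s, s.2, ?_⟩
    have := congrArg (Subtype.val) h
    have h2 : z * (s : K) = r := this
    rw [mul_comm, h2]; exact r.2
  · rintro ⟨s, hs, h⟩
    have hu : IsUnit (algebraMap S (LocalSubring.ofPrime S P).toSubring s) := by
      rw [IsLocalization.AtPrime.isUnit_to_map_iff _ P]; exact hs
    obtain ⟨u, hu⟩ := hu
    have h1 : ((u⁻¹ : _ˣ) : (LocalSubring.ofPrime S P).toSubring) * u = 1 := by simp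
    rw [hu] at h1
    have h2 : ((((u⁻¹ : _ˣ) : (LocalSubring.ofPrime S P).toSubring)) : K) * s = 1 :=
      congrArg Subtype.val h1
    have : z = ((((u⁻¹ : _ˣ) : (LocalSubring.ofPrime S P).toSubring)) : K) * (s * z) := by
      rw [← mul_assoc, h2, one_mul]
    rw [this]
    exact Subring.mul_mem _ (Subtype.property _) (LocalSubring.le_ofPrime S P h)

/-- complement of a prime, as a submonoid of `K`. -/
def pcompl (S : Subring K) (P : Ideal S) [P.IsPrime] : Submonoid K :=
  P.primeCompl.map S.subtype.toMonoidHom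

lemma mem_pcompl (S : Subring K) (P : Ideal S) [P.IsPrime] (z : K) :
    z ∈ pcompl S P ↔ ∃ s : S, s ∉ P ∧ (s : K) = z := Iff.rfl

lemma loc_prime (S : Subring K) (P : Ideal S) [P.IsPrime] (J : Set K) (hJ : J.Nonempty) (q : K)
    (hq : ∀ V : ValuationSubring K, (LocalSubring.ofPrime S P).toSubring ≤ V.toSubring →
      Cov V J q) :
    ∃ s : S, s ∉ P ∧ ∀ V : ValuationSubring K, S ≤ V.toSubring → Cov V J (s * q) := by
  obtain ⟨_, ⟨s, hs, rfl⟩, h⟩ := loc S _ (pcompl S P) (by rintro _ ⟨s, _, rfl⟩; exact s.2)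
    (by
      rintro ⟨s, hs, h⟩
      have : s = 0 := Subtype.ext h
      exact hs (this ▸ P.zero_mem))
    (by
      intro b hb
      obtain ⟨s, hs, h⟩ := (mem_ofPrime S P b).1 hb
      exact ⟨s, ⟨s, hs, rfl⟩, h⟩) J hJ q hq
  exact ⟨s, hs, h⟩

lemma norm_prime (S : Subring K) (P : Ideal S) [P.IsPrime] (hS : Norm S) :
    Norm (LocalSubring.ofPrime S P).toSubring := by
  intro z hz
  rw [mem_ofPrime]
  obtain ⟨s, hs, h⟩ := loc_prime S P {1} ⟨1, rfl⟩ z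
    (fun V hV => ⟨1, rfl, z, hz V hV, by simp⟩)
  refine ⟨s, hs, hS _ fun V hV => ?_⟩
  obtain ⟨i, hi, w, hw, e⟩ := h V hV
  rw [Set.mem_singleton_iff] at hi
  rw [e, hi, one_mul]; exact hw

end basic
end Verma

namespace Verma

section claim
variable {K : Type*} [Field K]

/-- valuative joint reduction condition -/
def JR (I J : Set K) (a b : K) (V : ValuationSubring K) : Prop :=
  (∀ i ∈ I, ∃ w ∈ V, i = a * w) ∨ (∀ j ∈ J, ∃ w ∈ V, j = b * w)

/-- the conclusion over a subring `A` -/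
def Claim (I J : Set K) (a b : K) (A : Subring K) : Prop :=
  ∀ z : K, (∀ V : ValuationSubring K, A ≤ V.toSubring → ∃ i ∈ I, ∃ j ∈ J, ∃ w ∈ V, z = i * j * w) →
    ∃ p q : K, z = a * q + b * p ∧
      ∀ V : ValuationSubring K, A ≤ V.toSubring → Cov V J q ∧ Cov V I p

/-- the affine chart `A[t]` -/
noncomputable def chart (A : Subring K) (t : K) : Subring K := (Polynomial.eval₂RingHom A.subtype t).range

lemma mem_chart {A : Subring K} {t z : K} :
    z ∈ chart A t ↔ ∃ F : Polynomial A, F.eval₂ A.subtype t = z := by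
  simp [chart, RingHom.mem_range]

lemma le_chart (A : Subring K) (t : K) : A ≤ chart A t := fun a ha =>
  mem_chart.2 ⟨Polynomial.C ⟨a, ha⟩, by simp⟩

lemma self_mem_chart (A : Subring K) (t : K) : t ∈ chart A t :=
  mem_chart.2 ⟨Polynomial.X, by simp⟩

lemma chart_le {A B : Subring K} {t : K} (h : A ≤ B) (ht : t ∈ B) : chart A t ≤ B := by
  intro z hz
  obtain ⟨F, rfl⟩ := mem_chart.1 hz
  rw [Polynomial.eval₂_eq_sum_range]
  exact B.sum_mem fun i _ => B.mul_mem (h (Subtype.property _)) (B.pow_mem ht _)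

lemma split_chart (A : Subring K) (t : K) (ht : t ≠ 0) (n : ℕ) (τ : K)
    (h : t ^ n * τ ∈ chart A t) : ∃ u ∈ chart A t, ∃ v ∈ chart A t⁻¹, τ = u + v := by
  obtain ⟨F, hF⟩ := mem_chart.1 h
  have : τ = F.eval₂ A.subtype t * t⁻¹ ^ n := by
    rw [hF, inv_pow]; field_simp
  rw [this]
  clear this hF h
  induction F using Polynomial.induction_on' with
  | add F G hF hG =>
    obtain ⟨u, hu, v, hv, e⟩ := hF
    obtain ⟨u', hu', v', hv', e'⟩ := hG
    exact ⟨u + u', Subring.add_mem _ hu hu', v + v', Subring.add_mem _ hv hv', by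
      rw [Polynomial.eval₂_add, add_mul, e, e']; ring⟩
  | monomial i c =>
    rw [Polynomial.eval₂_monomial]
    rcases le_total n i with h | h
    · refine ⟨c * t ^ (i - n), Subring.mul_mem _ (le_chart A t c.2)
        (Subring.pow_mem _ (self_mem_chart A t) _), 0, Subring.zero_mem _, ?_⟩
      obtain ⟨k, rfl⟩ := Nat.exists_eq_add_of_le h
      simp only [Nat.add_sub_cancel_left, pow_add, inv_pow, Subring.coe_subtype]
      field_simp
      simp
    · refine ⟨0, Subring.zero_mem _, c * t⁻¹ ^ (n - i), Subring.mul_mem _ (le_chart A _ c.2)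
        (Subring.pow_mem _ (self_mem_chart A _) _), ?_⟩
      obtain ⟨k, rfl⟩ := Nat.exists_eq_add_of_le h
      simp only [Nat.add_sub_cancel_left, pow_add, inv_pow, Subring.coe_subtype]
      field_simp
      simp

lemma glue (I J : Set K) (a b : K) (haI : a ∈ I) (hbJ : b ∈ J) (ha : a ≠ 0) (hb : b ≠ 0) (A : Subring K) (t : K) (ht : t ≠ 0)
    (hS : Norm (chart A t))
    (hJR : ∀ V : ValuationSubring K, A ≤ V.toSubring → JR I J a b V)
    (h1 : Claim I J a b (chart A t)) (h2 : Claim I J a b (chart A t⁻¹)) : Claim I J a b A := by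
  intro z hz
  obtain ⟨p1, q1, e1, c1⟩ := h1 z fun V hV => hz V ((le_chart A t).trans hV)
  obtain ⟨p2, q2, e2, c2⟩ := h2 z fun V hV => hz V ((le_chart A t⁻¹).trans hV)
  have heq : a * (q1 - q2) = b * (p2 - p1) := by linear_combination e2 - e1
  have htau : (q1 - q2) / b = (p2 - p1) / a := by field_simp; linear_combination heq
  have hle2 : chart A t⁻¹ ≤ powLoc (chart A t) t (self_mem_chart A t) :=
    chart_le ((le_chart A t).trans (le_powLoc _ _ _))
      ⟨1, by rw [pow_one, mul_inv_cancel₀ ht]; exact Subring.one_mem _⟩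
  have hmem : ∀ V : ValuationSubring K, powLoc (chart A t) t (self_mem_chart A t) ≤ V.toSubring →
      (q1 - q2) / b ∈ V := by
    intro V hV
    have hV1 := (le_powLoc (chart A t) t (self_mem_chart A t)).trans hV
    have hV2 := hle2.trans hV
    rcases hJR V ((le_chart A t).trans hV1) with h | h
    · obtain ⟨i, hi, w, hw, e⟩ := (c2 V hV2).2.sub (c1 V hV1).2
      obtain ⟨w', hw', rfl⟩ := h i hi
      rw [htau, e]
      have : a * w' * w / a = w' * w := by field_simp
      rw [this]; exact V.mul_mem _ _ hw' hw
    · obtain ⟨i, hi, w, hw, e⟩ := (c1 V hV1).1.sub (c2 V hV2).1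
      obtain ⟨w', hw', rfl⟩ := h i hi
      rw [e]
      have : b * w' * w / b = w' * w := by field_simp
      rw [this]; exact V.mul_mem _ _ hw' hw
  obtain ⟨n, hn⟩ := norm_powLoc _ _ _ ht hS _ hmem
  obtain ⟨u, hu, v, hv, e⟩ := split_chart A t ht n _ hn
  have eq : q1 - q2 = b * (u + v) := by rw [← e]; field_simp
  have ep : p2 - p1 = a * (u + v) := by rw [← e, htau]; field_simp
  refine ⟨p1 + a * u, q1 - b * u, by rw [e1]; ring, fun V hV => ?_⟩
  rcases V.mem_or_inv_mem t with h | h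
  · have hV1 : chart A t ≤ V.toSubring := chart_le hV h
    exact ⟨(c1 V hV1).1.sub ⟨b, hbJ, u, hV1 hu, rfl⟩, (c1 V hV1).2.add ⟨a, haI, u, hV1 hu, rfl⟩⟩
  · have hV2 : chart A t⁻¹ ≤ V.toSubring := chart_le hV h
    have e3 : q1 - b * u = q2 + b * v := by linear_combination eq
    have e4 : p1 + a * u = p2 - a * v := by linear_combination -ep
    rw [e3, e4]
    exact ⟨(c2 V hV2).1.add ⟨b, hbJ, v, hV2 hv, rfl⟩, (c2 V hV2).2.sub ⟨a, haI, v, hV2 hv, rfl⟩⟩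

lemma local_global (I J : Set K) (a b : K) (hI : I.Nonempty) (hJ : J.Nonempty) (S : Subring K)
    (h : ∀ (N : Ideal S) [N.IsMaximal], Claim I J a b (LocalSubring.ofPrime S N).toSubring) :
    Claim I J a b S := by
  intro z hz
  let 𝔟 : Ideal S :=
    { carrier := {s | ∃ p q : K, s * z = a * q + b * p ∧
        ∀ V : ValuationSubring K, S ≤ V.toSubring → Cov V J q ∧ Cov V I p}
      add_mem' := by
        rintro s s' ⟨p, q, e, h⟩ ⟨p', q', e', h'⟩
        exact ⟨p + p', q + q', by rw [Subring.coe_add, add_mul, e, e']; ring,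
          fun V hV => ⟨(h V hV).1.add (h' V hV).1, (h V hV).2.add (h' V hV).2⟩⟩
      zero_mem' := by
        obtain ⟨i, hi⟩ := hI
        obtain ⟨j, hj⟩ := hJ
        exact ⟨0, 0, by simp, fun V hV => ⟨⟨j, hj, 0, V.zero_mem, by simp⟩,
          ⟨i, hi, 0, V.zero_mem, by simp⟩⟩⟩
      smul_mem' := by
        rintro c s ⟨p, q, e, h⟩
        exact ⟨c * p, c * q, by rw [smul_eq_mul, Subring.coe_mul, mul_assoc, e]; ring,
          fun V hV => ⟨(h V hV).1.mul (hV c.2), (h V hV).2.mul (hV c.2)⟩⟩ }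
  have htop : 𝔟 = ⊤ := by
    by_contra hne
    obtain ⟨N, hN, hle⟩ := Ideal.exists_le_maximal _ hne
    obtain ⟨p, q, e, hc⟩ := h N z fun V hV => hz V ((LocalSubring.le_ofPrime S N).trans hV)
    obtain ⟨s, hs, h1⟩ := loc_prime S N J hJ q fun V hV => (hc V hV).1
    obtain ⟨s', hs', h2⟩ := loc_prime S N I hI p fun V hV => (hc V hV).2
    have hmem : s * s' ∈ 𝔟 := by
      refine ⟨s * s' * p, s * s' * q, by rw [e, Subring.coe_mul]; ring, fun V hV => ⟨?_, ?_⟩⟩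
      · have := (h1 V hV).mul (hV s'.2)
        rwa [show (s' : K) * (s * q) = s * s' * q by ring] at this
      · have := (h2 V hV).mul (hV s.2)
        rwa [show (s : K) * (s' * p) = s * s' * p by ring] at this
    rcases hN.isPrime.mem_or_mem (hle hmem) with h | h
    · exact hs h
    · exact hs' h
  have h1 : (1 : S) ∈ 𝔟 := htop ▸ Submodule.mem_top
  obtain ⟨p, q, e, hc⟩ := h1
  exact ⟨p, q, by simpa using e, hc⟩

/-- The ideal `h⁻¹ I J` -/
def Lid (I J : Set K) (A : Subring K) (h : K) : Ideal A :=
  Ideal.span {l | ∃ i ∈ I, ∃ j ∈ J, h * (l : K) = i * j}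

def Int (I J : Set K) (A : Subring K) (h : K) : Prop :=
  ∀ i ∈ I, ∀ j ∈ J, ∃ l : A, h * (l : K) = i * j

lemma base (I J : Set K) (a b : K) (ha : a ∈ I) (hb : b ∈ J) (ha0 : a ≠ 0) (hb0 : b ≠ 0)
    (A : Subring K) [IsLocalRing A] (h : K) (h0 : h ≠ 0)
    (hInt : Int I J A h) (hL : Lid I J A h = ⊤)
    (hJR : ∀ V : ValuationSubring K, A ≤ V.toSubring → JR I J a b V) : Claim I J a b A := by
  have : ∃ l : A, IsUnit l ∧ ∃ i ∈ I, ∃ j ∈ J, h * (l : K) = i * j := by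
    by_contra hc
    push Not at hc
    have : Lid I J A h ≤ maximalIdeal A := by
      rw [Lid, Ideal.span_le]
      rintro l ⟨i, hi, j, hj, e⟩
      by_contra hl
      have hu : IsUnit l := by simpa using hl
      exact hc l hu i hi j hj e
    rw [hL] at this
    exact (maximalIdeal.isMaximal A).ne_top (top_le_iff.1 this)
  obtain ⟨l, ⟨u, rfl⟩, i0, hi0, j0, hj0, e⟩ := this
  have hu : (((u⁻¹ : Aˣ) : A) : K) * ((u : A) : K) = 1 := by
    rw [← Subring.coe_mul]; simp
  have hu0 : ((u : A) : K) ≠ 0 := right_ne_zero_of_mul_eq_one hu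
  have hij : i0 * j0 ≠ 0 := by rw [← e]; exact mul_ne_zero h0 hu0
  have hi00 := left_ne_zero_of_mul hij
  have hj00 := right_ne_zero_of_mul hij
  have hh : h = i0 * j0 * (((u⁻¹ : Aˣ) : A) : K) := by
    rw [← e, mul_assoc, mul_comm ((u : A) : K), hu, mul_one]
  have hI : ∀ i ∈ I, ∃ α : A, i = i0 * α := by
    intro i hi
    obtain ⟨l, hl⟩ := hInt i hi j0 hj0
    refine ⟨((u⁻¹ : Aˣ) : A) * l, ?_⟩
    apply mul_right_cancel₀ hj00
    rw [← hl, hh, Subring.coe_mul]; ring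
  have hJ : ∀ j ∈ J, ∃ α : A, j = j0 * α := by
    intro j hj
    obtain ⟨l, hl⟩ := hInt i0 hi0 j hj
    refine ⟨((u⁻¹ : Aˣ) : A) * l, ?_⟩
    apply mul_left_cancel₀ hi00
    rw [← hl, hh, Subring.coe_mul]; ring
  obtain ⟨a', ea⟩ := hI a ha
  obtain ⟨b', eb⟩ := hJ b hb
  by_cases hua : IsUnit a'
  · obtain ⟨ua, rfl⟩ := hua
    have hua : ((ua : A) : K) * (((ua⁻¹ : Aˣ) : A) : K)  = 1 := by
      rw [← Subring.coe_mul]; simp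
    intro z hz
    refine ⟨0, z / a, by field_simp; ring, fun V hV => ⟨?_, i0, hi0, 0, V.zero_mem, by simp⟩⟩
    obtain ⟨i, hi, j, hj, w, hw, rfl⟩ := hz V hV
    obtain ⟨α, rfl⟩ := hI i hi
    refine ⟨j, hj, ((ua⁻¹ : Aˣ) : A) * α * w,
      V.mul_mem _ _ (V.mul_mem _ _ (hV (Subtype.property _)) (hV α.2)) hw, ?_⟩
    rw [div_eq_iff ha0, ea]
    linear_combination (-(i0 * α * j * w)) * hua
  by_cases hub : IsUnit b'
  · obtain ⟨ua, rfl⟩ := hub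
    have hua : ((ua : A) : K) * (((ua⁻¹ : Aˣ) : A) : K)  = 1 := by
      rw [← Subring.coe_mul]; simp
    intro z hz
    refine ⟨z / b, 0, by field_simp; ring, fun V hV => ⟨⟨j0, hj0, 0, V.zero_mem, by simp⟩, ?_⟩⟩
    obtain ⟨i, hi, j, hj, w, hw, rfl⟩ := hz V hV
    obtain ⟨α, rfl⟩ := hJ j hj
    refine ⟨i, hi, ((ua⁻¹ : Aˣ) : A) * α * w,
      V.mul_mem _ _ (V.mul_mem _ _ (hV (Subtype.property _)) (hV α.2)) hw, ?_⟩
    rw [div_eq_iff hb0, eb]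
    linear_combination (-(i * j0 * α * w)) * hua
  exfalso
  obtain ⟨V, hV, hP⟩ := exists_val_prime A (maximalIdeal A)
  have hva := (hP a').1 ((mem_maximalIdeal _).2 hua)
  have hvb := (hP b').1 ((mem_maximalIdeal _).2 hub)
  have aux : ∀ c w : K, V.valuation c < 1 → w ∈ V → c * w = 1 → False := by
    intro c w hc hw h
    have := mul_lt_one_of_lt_of_le hc ((V.valuation_le_one_iff w).2 hw)
    rw [← map_mul, h, map_one] at this
    exact lt_irrefl _ this
  rcases hJR V hV with h | h
  · obtain ⟨w, hw, e⟩ := h i0 hi0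
    refine aux a' w hva hw (mul_left_cancel₀ hi00 ?_)
    rw [← mul_assoc, ← ea, ← e, mul_one]
  · obtain ⟨w, hw, e⟩ := h j0 hj0
    refine aux b' w hvb hw (mul_left_cancel₀ hj00 ?_)
    rw [← mul_assoc, ← eb, ← e, mul_one]

end claim
end Verma

namespace Verma

section geom
variable {K : Type*} [Field K]

lemma ne_zero_of_np {A : Type*} [CommRing A] [IsLocalRing A] {x y : A}
    (hm : maximalIdeal A = Ideal.span {x, y})
    (hnp : ¬ (maximalIdeal A).IsPrincipal) : x ≠ 0 := by
  rintro rfl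
  apply hnp
  rw [hm, Ideal.span_insert_zero]
  exact ⟨⟨y, rfl⟩⟩

lemma dvd_of_np {A : Type*} [CommRing A] [IsLocalRing A] {x y : A}
    (hm : maximalIdeal A = Ideal.span {x, y})
    (hnp : ¬ (maximalIdeal A).IsPrincipal) : ¬ x ∣ y := by
  rintro ⟨c, rfl⟩
  apply hnp
  refine ⟨⟨x, ?_⟩⟩
  rw [hm]
  apply le_antisymm
  · rw [Ideal.span_le]
    rintro _ (rfl | rfl)
    · exact Ideal.mem_span_singleton_self _
    · exact Ideal.mul_mem_right _ _ (Ideal.mem_span_singleton_self _)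
  · exact Ideal.span_mono (by simp)

variable {A : Subring K} [IsLocalRing A] {x y : A} (hm : maximalIdeal A = Ideal.span {x, y})
  (hnp : ¬ (maximalIdeal A).IsPrincipal)

include hm hnp in
lemma reg (hN : Norm A) (p : A) (h : x ∣ y * p) : x ∣ p := by
  have hm' : maximalIdeal A = Ideal.span {y, x} := by rw [hm, Set.pair_comm]
  have hx : (x : K) ≠ 0 := by
    have := ne_zero_of_np hm hnp
    simpa using this
  have hy : (y : K) ≠ 0 := by
    have := ne_zero_of_np hm' hnp
    simpa using this
  obtain ⟨q, hq⟩ := h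
  have hqK : (y : K) * p = x * q := by exact_mod_cast congrArg Subtype.val hq
  by_cases hp : IsUnit p
  · obtain ⟨u, rfl⟩ := hp
    exfalso
    refine dvd_of_np hm hnp ⟨q * ((u⁻¹ : Aˣ) : A), ?_⟩
    rw [← mul_assoc, ← hq, mul_assoc, Units.mul_inv, mul_one]
  by_cases hqu : IsUnit q
  · obtain ⟨u, rfl⟩ := hqu
    exfalso
    refine dvd_of_np hm' hnp ⟨p * ((u⁻¹ : Aˣ) : A), ?_⟩
    rw [← mul_assoc, hq, mul_assoc, Units.mul_inv, mul_one]
  have hp' : p ∈ Ideal.span {x, y} := by rw [← hm]; exact hp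
  have hq' : q ∈ Ideal.span {x, y} := by rw [← hm]; exact hqu
  rw [Ideal.mem_span_pair] at hp' hq'
  obtain ⟨α, β, ep⟩ := hp'
  obtain ⟨γ, δ, eq⟩ := hq'
  have epK : (α : K) * x + β * y = p := by exact_mod_cast congrArg Subtype.val ep
  have eqK : (γ : K) * x + δ * y = q := by exact_mod_cast congrArg Subtype.val eq
  have hw : (p : K) / x ∈ A := by
    apply hN
    intro V hV
    rcases V.mem_or_inv_mem ((y : K) / x) with h | h
    · have : (p : K) / x = α + β * (y / x) := by rw [← epK]; field_simp
      rw [this]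
      exact V.add_mem _ _ (hV α.2) (V.mul_mem _ _ (hV β.2) h)
    · rw [inv_div] at h
      have : (p : K) / x = γ * (x / y) + δ := by
        field_simp; linear_combination hqK - (x : K) * eqK
      rw [this]
      exact V.add_mem _ _ (V.mul_mem _ _ (hV γ.2) h) (hV δ.2)
  refine ⟨⟨_, hw⟩, Subtype.ext ?_⟩
  rw [Subring.coe_mul]
  field_simp

include hm in
lemma scale (hx : (x : K) ≠ 0) (𝔠 : Ideal A) (n : ℕ) (F : Polynomial A) (hF : F.natDegree ≤ n)
    (hc : ∀ i, F.coeff i ∈ 𝔠) :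
    ∃ r ∈ 𝔠 * maximalIdeal A ^ n, (x : K) ^ n * F.eval₂ A.subtype ((y : K) / x) = r := by
  refine ⟨∑ i ∈ Finset.range (n + 1), F.coeff i * (x ^ (n - i) * y ^ i), ?_, ?_⟩
  · refine Ideal.sum_mem _ fun i hi => Ideal.mul_mem_mul (hc i) ?_
    have hi' : i ≤ n := by simpa [Nat.lt_succ_iff] using hi
    have : maximalIdeal A ^ n = maximalIdeal A ^ (n - i) * maximalIdeal A ^ i := by
      rw [← pow_add]; congr 1; omega
    rw [this]
    refine Ideal.mul_mem_mul (Ideal.pow_mem_pow ?_ _) (Ideal.pow_mem_pow ?_ _)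
    · rw [hm]; exact Ideal.subset_span (by simp)
    · rw [hm]; exact Ideal.subset_span (by simp)
  · rw [Polynomial.eval₂_eq_sum_range' _ (Nat.lt_succ_of_le hF), Finset.mul_sum]
    push_cast
    refine Finset.sum_congr rfl fun i hi => ?_
    have hi' : i ≤ n := by simpa [Nat.lt_succ_iff] using hi
    obtain ⟨k, rfl⟩ := Nat.exists_eq_add_of_le hi'
    simp only [Nat.add_sub_cancel_left, Subring.coe_subtype, div_pow, pow_add]
    field_simp

include hm in
lemma pform (hx : (x : K) ≠ 0) (n : ℕ) (z : A) (hz : z ∈ maximalIdeal A ^ n) :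
    ∃ F : Polynomial A, F.natDegree ≤ n ∧
      (z : K) = (x : K) ^ n * F.eval₂ A.subtype ((y : K) / x) := by
  induction n generalizing z with
  | zero => exact ⟨Polynomial.C z, by simp, by simp⟩
  | succ n ih =>
    rw [pow_succ] at hz
    induction hz using Submodule.mul_induction_on' with
    | mem_mul_mem c hc d hd =>
      obtain ⟨F, hF, e⟩ := ih c hc
      rw [hm, Ideal.mem_span_pair] at hd
      obtain ⟨α, β, ed⟩ := hd
      refine ⟨F * (Polynomial.C β * Polynomial.X + Polynomial.C α), ?_, ?_⟩
      · refine Polynomial.natDegree_mul_le.trans (Nat.add_le_add hF Polynomial.natDegree_linear_le)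
      · rw [Polynomial.eval₂_mul, Subring.coe_mul, e, ← ed]
        simp
        field_simp
        ring
    | add c _ d _ hc hd =>
      obtain ⟨F, hF, e⟩ := hc
      obtain ⟨G, hG, e'⟩ := hd
      refine ⟨F + G, Polynomial.natDegree_add_le_of_degree_le hF hG, ?_⟩
      rw [Polynomial.eval₂_add, Subring.coe_add, e, e']; ring

include hm hnp in
lemma ker_le (hN : Norm A) (n : ℕ) (F : Polynomial A) (hF : F.natDegree ≤ n)
    (h : F.eval₂ A.subtype ((y : K) / x) = 0) :
    F ∈ (maximalIdeal A).map (Polynomial.C) := by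
  have hx : (x : K) ≠ 0 := by
    have := ne_zero_of_np hm hnp
    simpa using this
  have hxm : x ∈ maximalIdeal A := by rw [hm]; exact Ideal.subset_span (by simp)
  have hym : y ∈ maximalIdeal A := by rw [hm]; exact Ideal.subset_span (by simp)
  induction n generalizing F with
  | zero =>
    rw [Polynomial.eq_C_of_natDegree_le_zero hF] at h ⊢
    simp only [Polynomial.eval₂_C, Subring.coe_subtype] at h
    have : F.coeff 0 = 0 := Subtype.ext h
    rw [this]; simp
  | succ n ih =>
    set c := F.coeff (n + 1) with hc
    set F' := F - Polynomial.monomial (n + 1) c with hF'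
    have hF'd : F'.natDegree ≤ n := by
      rw [Polynomial.natDegree_le_iff_coeff_eq_zero]
      intro N hN
      rw [hF', Polynomial.coeff_sub, Polynomial.coeff_monomial]
      split_ifs with h1
      · rw [← h1, hc, sub_self]
      · rw [sub_zero]
        exact Polynomial.coeff_eq_zero_of_natDegree_lt (by omega)
    have hFF' : F = F' + Polynomial.monomial (n + 1) c := by rw [hF']; ring
    obtain ⟨r, -, hr⟩ := scale hm hx ⊤ n F' hF'd (fun _ => trivial)
    have hdv : x ∣ y ^ (n + 1) * c := by
      refine ⟨-r, Subtype.ext ?_⟩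
      push_cast
      rw [← hr]
      rw [hFF', Polynomial.eval₂_add, Polynomial.eval₂_monomial, Subring.coe_subtype, div_pow] at h
      field_simp at h
      linear_combination h
    have hdv2 : ∀ k, ∀ c : A, x ∣ y ^ k * c → x ∣ c := by
      intro k
      induction k with
      | zero => intro c h; simpa using h
      | succ k ih =>
        intro c h
        rw [pow_succ, mul_assoc] at h
        exact reg hm hnp hN _ (ih _ h)
    obtain ⟨c', hc'⟩ := hdv2 _ _ hdv
    have hG : F' + Polynomial.monomial n (c' * y) ∈ (maximalIdeal A).map (Polynomial.C) := by
      apply ih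
      · exact Polynomial.natDegree_add_le_of_degree_le hF'd (Polynomial.natDegree_monomial_le _)
      · rw [← h, hFF', Polynomial.eval₂_add, Polynomial.eval₂_add, Polynomial.eval₂_monomial,
          Polynomial.eval₂_monomial, hc']
        simp only [Subring.coe_subtype, Subring.coe_mul, pow_succ]
        field_simp
    have h1 : Polynomial.monomial n (c' * y) ∈ (maximalIdeal A).map (Polynomial.C) := by
      rw [Ideal.mem_map_C_iff]
      intro k
      rw [Polynomial.coeff_monomial]
      split_ifs
      · exact Ideal.mul_mem_left _ _ hym
      · exact Ideal.zero_mem _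
    have h2 : Polynomial.monomial (n + 1) c ∈ (maximalIdeal A).map (Polynomial.C) := by
      rw [Ideal.mem_map_C_iff, hc']
      intro k
      rw [Polynomial.coeff_monomial]
      split_ifs
      · exact Ideal.mul_mem_right _ _ hxm
      · exact Ideal.zero_mem _
    rw [hFF']
    have := Ideal.add_mem _ (Ideal.sub_mem _ hG h1) h2
    simpa using this

include hm in
lemma eval_of_mem (hx : (x : K) ≠ 0) (F : Polynomial A)
    (hF : F ∈ (maximalIdeal A).map (Polynomial.C)) :
    ∃ s ∈ chart A ((y : K) / x), F.eval₂ A.subtype ((y : K) / x) = x * s := by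
  rw [Ideal.mem_map_C_iff] at hF
  refine ⟨∑ i ∈ Finset.range (F.natDegree + 1), (F.coeff i : K) / x * (y / x) ^ i, ?_, ?_⟩
  · refine Subring.sum_mem _ fun i _ => Subring.mul_mem _ ?_
      (Subring.pow_mem _ (self_mem_chart _ _) _)
    have := hF i
    rw [hm, Ideal.mem_span_pair] at this
    obtain ⟨α, β, e⟩ := this
    have : (F.coeff i : K) / x = α + β * (y / x) := by
      rw [← e]; push_cast; field_simp
    rw [this]
    exact Subring.add_mem _ (le_chart _ _ α.2)
      (Subring.mul_mem _ (le_chart _ _ β.2) (self_mem_chart _ _))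
  · rw [Polynomial.eval₂_eq_sum_range, Finset.mul_sum]
    refine Finset.sum_congr rfl fun i _ => ?_
    simp only [Subring.coe_subtype]
    field_simp

include hm hnp in
lemma norm_chart (hN : Norm A) : Norm (chart A ((y : K) / x)) := by
  have hx : (x : K) ≠ 0 := by
    have := ne_zero_of_np hm hnp
    simpa using this
  set t := (y : K) / x with ht
  have hxS : (x : K) ∈ chart A t := le_chart A t x.2
  let f : Polynomial A →+* chart A t := (Polynomial.eval₂RingHom A.subtype t).rangeRestrict
  have hfs : Function.Surjective f := RingHom.rangeRestrict_surjective _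
  have hker : RingHom.ker f ≤ (maximalIdeal A).map (Polynomial.C) := by
    intro F hF
    rw [RingHom.mem_ker] at hF
    exact ker_le hm hnp hN _ F le_rfl (congrArg Subtype.val hF)
  have hmp : ((maximalIdeal A).map (Polynomial.C (R := A))).IsPrime :=
    Ideal.isPrime_map_C_of_isPrime
  have hP : (((maximalIdeal A).map (Polynomial.C)).map f).IsPrime :=
    Ideal.map_isPrime_of_surjective hfs hker
  obtain ⟨V, hV, hVP⟩ := exists_val_prime _ (((maximalIdeal A).map (Polynomial.C)).map f)
  change chart A t ≤ V.toSubring at hV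
  have hvx : V.valuation (x : K) < 1 := by
    refine (hVP ⟨x, hxS⟩).1 ?_
    have h1 : f (Polynomial.C x) = ⟨x, hxS⟩ := Subtype.ext (Polynomial.eval₂_C _ _)
    rw [← h1]
    apply Ideal.mem_map_of_mem
    apply Ideal.mem_map_of_mem
    rw [hm]; exact Ideal.subset_span (by simp)
  intro z hz
  have hB : chart A t ≤ powLoc A (x : K) x.2 :=
    chart_le (le_powLoc _ _ _) ⟨1, by
      rw [ht, pow_one, mul_div_cancel₀ _ hx]; exact y.2⟩
  obtain ⟨n, hn⟩ := norm_powLoc A x x.2 hx hN z fun V hV => hz V (hB.trans hV)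
  replace hn := le_chart A t hn
  induction n with
  | zero => simpa using hn
  | succ n ih =>
    apply ih
    have hmem : (⟨_, hn⟩ : chart A t) ∈ ((maximalIdeal A).map (Polynomial.C)).map f := by
      by_contra hnot
      have h1 := (hVP ⟨_, hn⟩).2 hnot
      have h2 : V.valuation ((x : K) ^ (n + 1) * z) < 1 := by
        rw [pow_succ', mul_assoc, map_mul]
        refine mul_lt_one_of_lt_of_le hvx ((V.valuation_le_one_iff _).2 ?_)
        exact V.mul_mem _ _ (V.toSubring.pow_mem (hV hxS) _) (hz V hV)
      exact h2.ne h1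
    rw [Ideal.mem_map_iff_of_surjective f hfs] at hmem
    obtain ⟨F, hF, e⟩ := hmem
    obtain ⟨s, hs, e2⟩ := eval_of_mem hm hx F hF
    have e3 : F.eval₂ A.subtype t = (x : K) ^ (n + 1) * z := congrArg Subtype.val e
    rw [← ht, e3] at e2
    have : (x : K) ^ n * z = s := by
      apply mul_left_cancel₀ hx
      rw [← e2]; ring
    rw [this]; exact hs

include hm in
lemma two_gen (hx : (x : K) ≠ 0) (t : K) (ht : t = (y : K) / x) (N : Ideal (chart A t))
    (hxN : (⟨x, le_chart A _ x.2⟩ : chart A t) ∈ N) :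
    ∃ g, N = Ideal.span {⟨x, le_chart A _ x.2⟩, g} := by
  set X0 : chart A t := ⟨x, le_chart A _ x.2⟩
  let f : Polynomial A →+* chart A t := (Polynomial.eval₂RingHom A.subtype t).rangeRestrict
  have hfs : Function.Surjective f := RingHom.rangeRestrict_surjective _
  let ρ := Polynomial.mapRingHom (IsLocalRing.residue A)
  have hρ : Function.Surjective ρ := Polynomial.map_surjective _ IsLocalRing.residue_surjective
  obtain ⟨gb, hgb⟩ := (IsPrincipalIdealRing.principal ((N.comap f).map ρ)).principal
  obtain ⟨g, hg, rfl⟩ : ∃ g ∈ N.comap f, ρ g = gb := by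
    rw [← Ideal.mem_map_iff_of_surjective ρ hρ, hgb]
    exact Submodule.mem_span_singleton_self _
  refine ⟨f g, le_antisymm ?_ ?_⟩
  · intro s hs
    obtain ⟨F, rfl⟩ := hfs s
    have h1 : ρ F ∈ (N.comap f).map ρ := Ideal.mem_map_of_mem _ hs
    rw [hgb] at h1
    obtain ⟨q, hq⟩ := Ideal.mem_span_singleton'.1 h1
    obtain ⟨Q, rfl⟩ := hρ q
    have h2 : F - Q * g ∈ (maximalIdeal A).map (Polynomial.C) := by
      have : F - Q * g ∈ RingHom.ker ρ := by rw [RingHom.mem_ker, map_sub, map_mul, hq, sub_self]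
      rwa [Polynomial.ker_mapRingHom, IsLocalRing.ker_residue] at this
    obtain ⟨s, hs, e⟩ := eval_of_mem hm hx _ h2
    rw [← ht] at hs e
    rw [Ideal.mem_span_pair]
    refine ⟨⟨s, hs⟩, f Q, ?_⟩
    have : f (F - Q * g) = X0 * ⟨s, hs⟩ := Subtype.ext e
    rw [map_sub, map_mul] at this
    linear_combination -this
  · rw [Ideal.span_le]
    rintro _ (rfl | rfl)
    · exact hxN
    · exact hg

end geom
end Verma

namespace Verma

section measure
variable {K : Type*} [Field K]

/-- chains of ideals above `L` have length at most `n`. -/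
def Bound {A : Type*} [CommRing A] (L : Ideal A) (n : ℕ) : Prop :=
  ∀ p : LTSeries (Set.Ici L), p.length ≤ n

lemma star {I J : Set K} {A B : Subring K} {h : K} (hAB : A ≤ B) (hInt : Int I J A h)
    (c : K) (hc : c ≠ 0)
    (H : ∀ l ∈ Lid I J A h, ∃ s ∈ B, (l : K) = c * s) :
    Int I J B (h * c) ∧ ∀ l ∈ Lid I J A h, ∃ s ∈ Lid I J B (h * c), (l : K) = c * s := by
  constructor
  · intro i hi j hj
    obtain ⟨l, hl⟩ := hInt i hi j hj
    obtain ⟨s, hs, e⟩ := H l (Ideal.subset_span ⟨i, hi, j, hj, hl⟩)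
    exact ⟨⟨s, hs⟩, by rw [mul_assoc, ← e, hl]⟩
  · intro l hl
    induction hl using Submodule.span_induction with
    | mem l hl =>
      obtain ⟨s, hs, e⟩ := H l (Ideal.subset_span hl)
      obtain ⟨i, hi, j, hj, hl⟩ := hl
      exact ⟨⟨s, hs⟩, Ideal.subset_span ⟨i, hi, j, hj, by rw [mul_assoc, ← e, hl]⟩, e⟩
    | zero => exact ⟨0, Ideal.zero_mem _, by simp⟩
    | add l l' _ _ hl hl' =>
      obtain ⟨s, hs, e⟩ := hl
      obtain ⟨s', hs', e'⟩ := hl'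
      exact ⟨s + s', Ideal.add_mem _ hs hs', by push_cast; rw [e, e']; ring⟩
    | smul d l _ hl =>
      obtain ⟨s, hs, e⟩ := hl
      refine ⟨⟨d, hAB d.2⟩ * s, Ideal.mul_mem_left _ _ hs, ?_⟩
      rw [smul_eq_mul]; push_cast; rw [e]; ring

lemma nilp {A : Type*} [CommRing A] [IsLocalRing A] [IsNoetherianRing A] (L : Ideal A) (n : ℕ)
    (h : Bound L n) : ∃ k, maximalIdeal A ^ k ≤ L := by
  by_contra hc
  push Not at hc
  have hstep : ∀ i, maximalIdeal A ^ (i + 1) ⊔ L < maximalIdeal A ^ i ⊔ L := by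
    intro i
    refine lt_of_le_of_ne (sup_le_sup_right (Ideal.pow_le_pow_right (Nat.le_succ i)) _) ?_
    intro heq
    apply hc i
    apply Submodule.le_of_le_smul_of_le_jacobson_bot (I := maximalIdeal A)
      (IsNoetherian.noetherian _) (IsLocalRing.maximalIdeal_le_jacobson _)
    rw [smul_eq_mul, ← pow_succ', sup_comm, heq]
    exact le_sup_left
  have hanti : StrictAnti fun i => maximalIdeal A ^ i ⊔ L := strictAnti_nat_of_succ_lt hstep
  have := h (LTSeries.mk (n + 1) (fun j => ⟨maximalIdeal A ^ (n + 1 - (j : ℕ)) ⊔ L, Set.mem_Ici.2 le_sup_right⟩)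
    (by
      intro i j hij
      apply hanti
      have := j.2
      have : (i : ℕ) < j := hij
      omega))
  have h2 : n + 1 ≤ n := this
  omega

lemma exists_ord {A : Type*} [CommRing A] [IsDomain A] [IsLocalRing A] [IsNoetherianRing A]
    {x : A} (hx0 : x ≠ 0) (hxm : x ∈ maximalIdeal A)
    (L : Ideal A) (k : ℕ) (hk : maximalIdeal A ^ k ≤ L) (hL : L ≠ ⊤) :
    ∃ e, L ≤ maximalIdeal A ^ (e + 1) ∧ ¬ L ≤ maximalIdeal A ^ (e + 2) := by
  classical
  have hlt : ∀ k, ¬ maximalIdeal A ^ k ≤ maximalIdeal A ^ (k + 1) := by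
    intro k hle
    have : maximalIdeal A ^ k ≤ ⊥ := by
      apply Submodule.le_of_le_smul_of_le_jacobson_bot (I := maximalIdeal A)
        (IsNoetherian.noetherian _) (IsLocalRing.maximalIdeal_le_jacobson _)
      rw [smul_eq_mul, ← pow_succ']
      exact hle.trans le_sup_right
    have h2 := this (Ideal.pow_mem_pow hxm k)
    exact pow_ne_zero k hx0 (by simpa using h2)
  have hex : ∃ e, ¬ L ≤ maximalIdeal A ^ (e + 2) := by
    refine ⟨k, fun h => hlt k (hk.trans (h.trans (Ideal.pow_le_pow_right (by omega))))⟩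
  refine ⟨Nat.find hex, ?_, Nat.find_spec hex⟩
  rcases Nat.eq_zero_or_pos (Nat.find hex) with h0 | h0
  · rw [h0, zero_add, pow_one]
    exact IsLocalRing.le_maximalIdeal hL
  · have := Nat.find_min hex (Nat.sub_lt h0 one_pos)
    rw [not_not] at this
    rwa [show Nat.find hex - 1 + 2 = Nat.find hex + 1 by omega] at this

variable {A : Subring K} [IsLocalRing A] {x y : A} (hm : maximalIdeal A = Ideal.span {x, y})

include hm in
lemma surj_aux (hx : (x : K) ≠ 0) (t : K) (ht : t = (y : K) / x) (L : Ideal A) (e k : ℕ)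
    (hk : maximalIdeal A ^ k ≤ L) (hLe : L ≤ maximalIdeal A ^ (e + 1))
    (hLe2 : ¬ L ≤ maximalIdeal A ^ (e + 2))
    (B : Subring K) (hSB : chart A t ≤ B) (L' : Ideal B)
    (H : ∀ l ∈ L, ∃ s ∈ L', (l : K) = (x : K) ^ (e + 1) * s) (s : K) (hs : s ∈ chart A t) :
    ∃ z ∈ maximalIdeal A ^ e, ∃ w ∈ L', (x : K) ^ e * s = z + x ^ e * (w : K) := by
  have hxm : x ∈ maximalIdeal A := by rw [hm]; exact Ideal.subset_span (by simp)
  have hAB : A ≤ B := (le_chart A t).trans hSB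
  have step1 : ∀ s ∈ chart A t, ∃ s' ∈ chart A t, ∃ z ∈ maximalIdeal A ^ e, ∃ w ∈ L',
      (x : K) ^ e * s = z + x ^ e * (w : K) + x ^ e * (x * s') := by
    intro s hs
    obtain ⟨f, hfL, hf⟩ := Set.not_subset.1 hLe2
    obtain ⟨Φ, hΦd, hΦ⟩ := pform hm hx _ f (hLe hfL)
    obtain ⟨φ, hφ, eφ⟩ := H f hfL
    have hφΦ : (φ : K) = Φ.eval₂ A.subtype t := by
      apply mul_left_cancel₀ (pow_ne_zero (e + 1) hx)
      rw [← eφ, hΦ, ht]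
    obtain ⟨F, rfl⟩ := mem_chart.1 hs
    let ρ := IsLocalRing.residue A
    have hρ : Function.Surjective ρ := IsLocalRing.residue_surjective
    have hΦ0 : Φ.map ρ ≠ 0 := by
      intro h0
      apply hf
      obtain ⟨r, hr, er⟩ := scale hm hx (maximalIdeal A) (e + 1) Φ hΦd (by
        intro i
        have := congrArg (fun p => p.coeff i) h0
        simpa [ρ] using this)
      rw [← pow_succ'] at hr
      have : f = r := Subtype.ext (by rw [hΦ, er])
      rw [this]; exact hr
    obtain ⟨Q, hQ⟩ := Polynomial.map_surjective ρ hρ (F.map ρ / Φ.map ρ)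
    obtain ⟨R, hR, hRd⟩ := Polynomial.exists_degree_eq_of_mem_lifts
      (f := ρ) (p := F.map ρ % Φ.map ρ)
      ((Polynomial.mem_lifts _).2 (Polynomial.map_surjective ρ hρ _))
    have hRd' : R.natDegree ≤ e := by
      have h1 : R.degree < (Φ.map ρ).degree := by
        rw [hRd]; exact EuclideanDomain.mod_lt _ hΦ0
      have h2 : (Φ.map ρ).degree ≤ ((e + 1 : ℕ) : WithBot ℕ) :=
        Polynomial.degree_map_le.trans (Polynomial.degree_le_of_natDegree_le hΦd)
      have h3 := h1.trans_le h2
      rw [← Nat.lt_succ_iff]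
      by_cases hR0 : R = 0
      · simp [hR0]
      · rwa [Polynomial.degree_eq_natDegree hR0, Nat.cast_lt] at h3
    have hD : F - Φ * Q - R ∈ (maximalIdeal A).map (Polynomial.C) := by
      have : F - Φ * Q - R ∈ RingHom.ker (Polynomial.mapRingHom ρ) := by
        rw [RingHom.mem_ker]
        simp only [map_sub, map_mul, Polynomial.coe_mapRingHom, hQ, hR]
        have := EuclideanDomain.div_add_mod (F.map ρ) (Φ.map ρ)
        linear_combination -this
      rwa [Polynomial.ker_mapRingHom, IsLocalRing.ker_residue] at this
    obtain ⟨s', hs', es'⟩ := eval_of_mem hm hx _ hD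
    obtain ⟨z, hz, ez⟩ := scale hm hx ⊤ e R hRd' (fun _ => trivial)
    rw [← ht] at hs' es' ez
    have hQB : Q.eval₂ A.subtype t ∈ B := hSB (mem_chart.2 ⟨Q, rfl⟩)
    refine ⟨s', hs', z, by simpa using hz, ⟨_, hQB⟩ * φ, Ideal.mul_mem_left _ _ hφ, ?_⟩
    rw [Polynomial.eval₂_sub, Polynomial.eval₂_sub, Polynomial.eval₂_mul] at es'
    push_cast
    rw [hφΦ]
    linear_combination (x : K) ^ e * es' + ez
  have step2 : ∀ n, ∀ s ∈ chart A t, ∃ s' ∈ chart A t, ∃ z ∈ maximalIdeal A ^ e, ∃ w ∈ L',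
      (x : K) ^ e * s = z + x ^ e * (w : K) + x ^ e * (x ^ n * s') := by
    intro n
    induction n with
    | zero => exact fun s hs => ⟨s, hs, 0, Ideal.zero_mem _, 0, Ideal.zero_mem _, by simp⟩
    | succ n ih =>
      intro s hs
      obtain ⟨s', hs', z, hz, w, hw, e1⟩ := ih s hs
      obtain ⟨s'', hs'', z', hz', w', hw', e2⟩ := step1 s' hs'
      refine ⟨s'', hs'', z + x ^ n * z', Ideal.add_mem _ hz (Ideal.mul_mem_left _ _ hz'),
        w + ⟨x, hAB x.2⟩ ^ n * w', Ideal.add_mem _ hw (Ideal.mul_mem_left _ _ hw'), ?_⟩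
      push_cast
      linear_combination e1 + (x : K) ^ n * e2
  obtain ⟨s', hs', z, hz, w, hw, e1⟩ := step2 k s hs
  obtain ⟨u, hu, eu⟩ := H (x ^ k) (hk (Ideal.pow_mem_pow hxm k))
  refine ⟨z, hz, w + ⟨x, hAB x.2⟩ ^ (e + 1) * ⟨s', hSB hs'⟩ * u,
    Ideal.add_mem _ hw (Ideal.mul_mem_left _ _ hu), ?_⟩
  push_cast at eu ⊢
  linear_combination e1 + (x : K) ^ e * s' * eu

include hm in
lemma bound_step (hx : (x : K) ≠ 0) (t : K) (ht : t = (y : K) / x) (L : Ideal A) (e k n : ℕ)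
    (hk : maximalIdeal A ^ k ≤ L) (hLe : L ≤ maximalIdeal A ^ (e + 1))
    (hLe2 : ¬ L ≤ maximalIdeal A ^ (e + 2)) (hneL : ¬ maximalIdeal A ^ e ≤ L)
    (B : Subring K) (hSB : chart A t ≤ B)
    (hloc : ∀ q : B, ∃ s : B, IsUnit s ∧ (s : K) * q ∈ chart A t) (L' : Ideal B)
    (H : ∀ l ∈ L, ∃ s ∈ L', (l : K) = (x : K) ^ (e + 1) * s)
    (hb : Bound L (n + 1)) : Bound L' n := by
  have hAB : A ≤ B := (le_chart A t).trans hSB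
  have hxm : x ∈ maximalIdeal A := by rw [hm]; exact Ideal.subset_span (by simp)
  let g : Ideal B → Ideal A := fun P =>
    { carrier := {z | z ∈ maximalIdeal A ^ e ∧ ∃ w ∈ P, (z : K) = (x : K) ^ e * (w : K)}
      add_mem' := by
        rintro z z' ⟨hz, w, hw, e1⟩ ⟨hz', w', hw', e2⟩
        exact ⟨Ideal.add_mem _ hz hz', w + w', P.add_mem hw hw', by push_cast; rw [e1, e2]; ring⟩
      zero_mem' := ⟨Ideal.zero_mem _, 0, P.zero_mem, by simp⟩
      smul_mem' := by
        rintro c z ⟨hz, w, hw, e1⟩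
        refine ⟨Ideal.mul_mem_left _ _ hz, ⟨c, hAB c.2⟩ * w, P.mul_mem_left _ hw, ?_⟩
        rw [smul_eq_mul]; push_cast; rw [e1]; ring }
  have hgmono : ∀ P Q, P ≤ Q → g P ≤ g Q := by
    rintro P Q h z ⟨hz, w, hw, e1⟩
    exact ⟨hz, w, h hw, e1⟩
  have hgL : L ≤ g L' := by
    intro l hl
    obtain ⟨s, hs, e1⟩ := H l hl
    refine ⟨Ideal.pow_le_pow_right (Nat.le_succ e) (hLe hl), ⟨x, hAB x.2⟩ * s,
      L'.mul_mem_left _ hs, ?_⟩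
    push_cast; rw [e1]; ring
  have hgL2 : ¬ g L' ≤ L := by
    intro hle
    have : ∀ j, (∀ w ∈ maximalIdeal A ^ e, x ^ j * w ∈ L) → False := by
      intro j
      induction j with
      | zero => intro h; exact hneL fun w hw => by simpa using h w hw
      | succ j ih =>
        intro h
        apply ih
        intro w hw
        apply hle
        obtain ⟨s, hs, e1⟩ := H _ (h w hw)
        refine ⟨Ideal.mul_mem_left _ _ hw, s, hs, ?_⟩
        apply mul_left_cancel₀ hx
        push_cast at e1 ⊢
        linear_combination e1
    exact this k fun w hw => Ideal.mul_mem_right _ _ (hk (Ideal.pow_mem_pow hxm k))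
  have hginj : ∀ P Q, L' ≤ P → L' ≤ Q → g Q ≤ g P → Q ≤ P := by
    intro P Q hP hQ hle q hq
    obtain ⟨s, hu, hsq⟩ := hloc q
    rw [← Ideal.unit_mul_mem_iff_mem P hu]
    obtain ⟨z, hz, w, hw, e1⟩ := surj_aux hm hx t ht L e k hk hLe hLe2 B hSB L' H _ hsq
    have hzQ : z ∈ g Q := by
      refine ⟨hz, s * q - w, Q.sub_mem (Q.mul_mem_left _ hq) (hQ hw), ?_⟩
      push_cast
      linear_combination -e1
    obtain ⟨-, w', hw', e2⟩ := hle hzQ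
    have : s * q = w' + w := by
      apply Subtype.ext
      push_cast
      apply mul_left_cancel₀ (pow_ne_zero e hx)
      linear_combination e1 + e2
    rw [this]
    exact P.add_mem hw' (hP hw)
  intro p
  let G : Set.Ici L' → Set.Ici L := fun P => ⟨g P.1, Set.mem_Ici.2 (hgL.trans (hgmono _ _ P.2))⟩
  have hG : StrictMono G := by
    intro P Q hPQ
    have h1 : P.1 < Q.1 := hPQ
    exact lt_of_le_not_ge (hgmono _ _ h1.le) fun h => h1.not_ge (hginj _ _ P.2 Q.2 h)
  have hrel : (⟨L, Set.mem_Ici.2 le_rfl⟩ : Set.Ici L) < (p.map G hG).head := by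
    have : L < g (p.head).1 :=
      (lt_of_le_not_ge hgL hgL2).trans_le (hgmono _ _ p.head.2)
    exact this
  have := hb (RelSeries.cons (p.map G hG) ⟨L, Set.mem_Ici.2 le_rfl⟩ hrel)
  simp [RelSeries.cons_length] at this
  exact this

end measure

section main
variable {K : Type*} [Field K]

lemma not_bound_zero {A : Type*} [CommRing A] (L : Ideal A) (hL : L ≠ ⊤) : ¬ Bound L 0 := by
  intro h
  have := h (RelSeries.cons (RelSeries.singleton _ (⟨⊤, Set.mem_Ici.2 le_top⟩ : Set.Ici L)) ⟨L, Set.mem_Ici.2 le_rfl⟩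
    (show L < ⊤ from lt_top_iff_ne_top.2 hL))
  simp at this

theorem main (I J : Set K) (a b : K) (ha : a ∈ I) (hb : b ∈ J) (ha0 : a ≠ 0) (hb0 : b ≠ 0)
    (n : ℕ) : ∀ (A : Subring K) [IsLocalRing A] [IsNoetherianRing A] (x y : A)
      (_ : maximalIdeal A = Ideal.span {x, y}) (_ : Norm A) (h : K) (_ : h ≠ 0)
      (_ : Int I J A h) (_ : Bound (Lid I J A h) n)
      (_ : ∀ V : ValuationSubring K, A ≤ V.toSubring → JR I J a b V), Claim I J a b A := by
  induction n with
  | zero =>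
    intro A _ _ x y hm hN h h0 hInt hB hJR
    by_cases hL : Lid I J A h = ⊤
    · exact base I J a b ha hb ha0 hb0 A h h0 hInt hL hJR
    · exact absurd hB (not_bound_zero _ hL)
  | succ n ih =>
    intro A _ _ x y hm hN h h0 hInt hB hJR
    by_cases hL : Lid I J A h = ⊤
    · exact base I J a b ha hb ha0 hb0 A h h0 hInt hL hJR
    by_cases hnp : (maximalIdeal A).IsPrincipal
    · have hpid : IsPrincipalIdealRing A :=
        ((tfae_of_isNoetherianRing_of_isLocalRing_of_isDomain A).out 0 4).2 hnp
      obtain ⟨f, hf⟩ := (hpid.principal (Lid I J A h)).principal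
      obtain ⟨l, hl⟩ := hInt a ha b hb
      have hlL : l ∈ Lid I J A h := Ideal.subset_span ⟨a, ha, b, hb, hl⟩
      have H : ∀ l ∈ Lid I J A h, ∃ s ∈ A, (l : K) = f * s := by
        intro l hl
        rw [hf] at hl
        obtain ⟨c, rfl⟩ := Ideal.mem_span_singleton'.1 hl
        exact ⟨c, c.2, by push_cast; ring⟩
      have hf0 : (f : K) ≠ 0 := by
        intro h0
        obtain ⟨s, -, e⟩ := H l hlL
        rw [h0, zero_mul] at e
        rw [e, mul_zero] at hl
        exact mul_ne_zero ha0 hb0 hl.symm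
      obtain ⟨hInt', hst⟩ := star le_rfl hInt f hf0 H
      refine base I J a b ha hb ha0 hb0 A (h * f) (mul_ne_zero h0 hf0) hInt' ?_ hJR
      obtain ⟨s, hs, e⟩ := hst f (by rw [hf]; exact Submodule.mem_span_singleton_self _)
      rw [Ideal.eq_top_iff_one]
      have : s = 1 := Subtype.ext (mul_left_cancel₀ hf0 (by rw [← e]; simp))
      rwa [← this]
    · obtain ⟨k, hk⟩ := nilp _ _ hB
      have chartClaim : ∀ (x y : A) (_ : maximalIdeal A = Ideal.span {x, y}) (t : K)
          (_ : t = (y : K) / x), Claim I J a b (chart A t) := by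
        intro x y hm t ht
        have hx0 := ne_zero_of_np hm hnp
        have hx : (x : K) ≠ 0 := by simpa using hx0
        have hxm : x ∈ maximalIdeal A := by rw [hm]; exact Ideal.subset_span (by simp)
        have hNS : Norm (chart A t) := by rw [ht]; exact norm_chart hm hnp hN
        have : IsNoetherianRing (chart A t) := isNoetherianRing_range _
        obtain ⟨e, he1, he2⟩ := exists_ord hx0 hxm _ k hk hL
        have hneL : ¬ maximalIdeal A ^ e ≤ Lid I J A h := by
          intro hle
          exact he2 (he1.trans (by
            have h1 : maximalIdeal A ^ e ≤ maximalIdeal A ^ (e + 1) := hle.trans he1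
            calc maximalIdeal A ^ (e + 1) = maximalIdeal A * maximalIdeal A ^ e := pow_succ' _ _
              _ ≤ maximalIdeal A * maximalIdeal A ^ (e + 1) := Ideal.mul_mono_right h1
              _ = maximalIdeal A ^ (e + 2) := (pow_succ' _ _).symm))
        apply local_global I J a b ⟨a, ha⟩ ⟨b, hb⟩
        intro N hNmax
        have hSB := LocalSubring.le_ofPrime (chart A t) N
        have hloc : IsLocalization.AtPrime (LocalSubring.ofPrime (chart A t) N).toSubring N :=
          inferInstance
        have hNB := norm_prime (chart A t) N hNS
        have hnoe : IsNoetherianRing (LocalSubring.ofPrime (chart A t) N).toSubring :=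
          IsLocalization.isNoetherianRing N.primeCompl _ inferInstance
        have hAB := (le_chart A t).trans hSB
        obtain ⟨hInt', hst⟩ := star hAB hInt ((x : K) ^ (e + 1)) (pow_ne_zero _ hx) (by
          intro l hl
          obtain ⟨F, -, eF⟩ := pform hm hx _ l (he1 hl)
          rw [← ht] at eF
          exact ⟨_, hSB (mem_chart.2 ⟨F, rfl⟩), eF⟩)
        have h0' : h * (x : K) ^ (e + 1) ≠ 0 := mul_ne_zero h0 (pow_ne_zero _ hx)
        have hJR' : ∀ V : ValuationSubring K,
            (LocalSubring.ofPrime (chart A t) N).toSubring ≤ V.toSubring → JR I J a b V :=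
          fun V hV => hJR V (hAB.trans hV)
        by_cases hL' : Lid I J (LocalSubring.ofPrime (chart A t) N).toSubring
            (h * (x : K) ^ (e + 1)) = ⊤
        · exact base I J a b ha hb ha0 hb0 _ _ h0' hInt' hL' hJR'
        have hB' := bound_step hm hx t ht _ e k n hk he1 he2 hneL _ hSB (by
          intro q
          obtain ⟨s, hs, hsq⟩ := (mem_ofPrime (chart A t) N q).1 q.2
          exact ⟨algebraMap (chart A t) _ s, by
            rw [IsLocalization.AtPrime.isUnit_to_map_iff _ N]; exact hs, hsq⟩) _ hst hB
        have hxN : (⟨x, le_chart A _ x.2⟩ : chart A t) ∈ N := by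
          by_contra hxN
          have hu : IsUnit (algebraMap (chart A t) (LocalSubring.ofPrime (chart A t) N).toSubring
              ⟨x, le_chart A _ x.2⟩) := by
            rw [IsLocalization.AtPrime.isUnit_to_map_iff _ N]; exact hxN
          apply hL'
          obtain ⟨u, hu', eu⟩ := hst (x ^ k) (hk (Ideal.pow_mem_pow hxm k))
          apply Ideal.eq_top_of_isUnit_mem _ (Ideal.mul_mem_left _
            ((algebraMap (chart A t) (LocalSubring.ofPrime (chart A t) N).toSubring
              ⟨x, le_chart A _ x.2⟩) ^ (e + 1)) hu')
          have : (algebraMap (chart A t) (LocalSubring.ofPrime (chart A t) N).toSubring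
              ⟨x, le_chart A _ x.2⟩) ^ (e + 1) * u = (algebraMap (chart A t)
              (LocalSubring.ofPrime (chart A t) N).toSubring ⟨x, le_chart A _ x.2⟩) ^ k := by
            apply Subtype.ext
            push_cast
            exact eu.symm
          rw [this]
          exact hu.pow k
        obtain ⟨g, hg⟩ := two_gen hm hx t ht N hxN
        have hmB : maximalIdeal (LocalSubring.ofPrime (chart A t) N).toSubring =
            Ideal.span {algebraMap (chart A t) _ ⟨x, le_chart A _ x.2⟩,
              algebraMap (chart A t) _ g} := by
          have := congrArg (Ideal.map (algebraMap (chart A t)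
            (LocalSubring.ofPrime (chart A t) N).toSubring)) hg
          rw [Ideal.map_span, Set.image_pair] at this
          exact (IsLocalization.AtPrime.map_eq_maximalIdeal N _).symm.trans this
        exact ih _ _ _ hmB hNB _ h0' hInt' hB' hJR'
      have hm' : maximalIdeal A = Ideal.span {y, x} := by rw [hm, Set.pair_comm]
      have hx : (x : K) ≠ 0 := by simpa using ne_zero_of_np hm hnp
      have hy : (y : K) ≠ 0 := by simpa using ne_zero_of_np hm' hnp
      exact glue I J a b ha hb ha0 hb0 A ((y : K) / x) (div_ne_zero hy hx)
        (norm_chart hm hnp hN) hJR (chartClaim x y hm _ rfl)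
        (chartClaim y x hm' _ (by rw [inv_div]))

end main
end Verma

namespace Verma

section ufd
variable {R : Type*} [CommRing R] [IsNoetherianRing R] [IsLocalRing R]

lemma pow_unit_of_principal (y : R) (hm : maximalIdeal R = Ideal.span {y}) (p : R) (hp : p ≠ 0) :
    ∃ n u, IsUnit u ∧ p = y ^ n * u := by
  classical
  have hex : ∃ n, p ∉ maximalIdeal R ^ n := by
    by_contra hc
    push Not at hc
    apply hp
    have : p ∈ (⨅ n : ℕ, maximalIdeal R ^ n) := by simpa [Submodule.mem_iInf] using hc
    rwa [Ideal.iInf_pow_eq_bot_of_isLocalRing _ (IsLocalRing.maximalIdeal.isMaximal R).ne_top,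
      Ideal.mem_bot] at this
  obtain ⟨N, hN, hmin⟩ : ∃ N, p ∉ maximalIdeal R ^ N ∧ ∀ k < N, p ∈ maximalIdeal R ^ k :=
    ⟨Nat.find hex, Nat.find_spec hex, fun k hk => not_not.1 (Nat.find_min hex hk)⟩
  rcases N with _ | N
  · simp at hN
  have h1 := hmin N (Nat.lt_succ_self N)
  rw [hm, Ideal.span_singleton_pow, Ideal.mem_span_singleton'] at h1
  obtain ⟨u, hu⟩ := h1
  refine ⟨N, u, ?_, by rw [← hu, mul_comm]⟩
  by_contra hnu
  apply hN
  have hu' : u ∈ maximalIdeal R := hnu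
  rw [hm, Ideal.mem_span_singleton'] at hu'
  obtain ⟨v, rfl⟩ := hu'
  rw [hm, Ideal.span_singleton_pow, Ideal.mem_span_singleton', ← hu]
  exact ⟨v, by ring⟩

lemma not_pow_mem (hdim : ringKrullDim R = 2) (x y : R)
    (hm : maximalIdeal R = Ideal.span {x, y}) (k : ℕ) : y ^ k ∉ Ideal.span {x} := by
  intro hk
  have hxm : x ∈ maximalIdeal R := by rw [hm]; exact Ideal.subset_span (by simp)
  have hmin : maximalIdeal R ∈ (Ideal.span {x}).minimalPrimes := by
    refine ⟨⟨inferInstance, by rwa [Ideal.span_singleton_le_iff_mem]⟩, ?_⟩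
    rintro Q ⟨hQ, hxQ⟩ -
    rw [hm, Ideal.span_le]
    rintro z (rfl | rfl)
    · exact hxQ (Ideal.mem_span_singleton_self _)
    · exact hQ.mem_of_pow_mem _ (hxQ hk)
  have h1 := Ideal.height_le_one_of_isPrincipal_of_mem_minimalPrimes _ _ hmin
  have h2 := IsLocalRing.maximalIdeal_height_eq_ringKrullDim (R := R)
  rw [hdim] at h2
  have h3 : (maximalIdeal R).height = 2 := WithBot.coe_injective h2
  rw [h3] at h1
  exact absurd h1 (by decide)

lemma quot_max (x y : R) (hm : maximalIdeal R = Ideal.span {x, y})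
    [IsLocalRing (R ⧸ Ideal.span {x})] :
    maximalIdeal (R ⧸ Ideal.span {x}) = Ideal.span {Ideal.Quotient.mk (Ideal.span {x}) y} := by
  have h := IsLocalRing.map_maximalIdeal_of_surjective (Ideal.Quotient.mk (Ideal.span {x}))
    Ideal.Quotient.mk_surjective
  rw [← h, hm, Ideal.map_span, Set.image_pair]
  rw [Ideal.Quotient.eq_zero_iff_mem.2 (Ideal.mem_span_singleton_self x)]
  apply le_antisymm
  · rw [Ideal.span_le]
    rintro z (rfl | rfl)
    · exact Ideal.zero_mem _
    · exact Ideal.mem_span_singleton_self _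
  · exact Ideal.span_mono (by simp)

lemma quot_local (x y : R) (hm : maximalIdeal R = Ideal.span {x, y}) :
    IsLocalRing (R ⧸ Ideal.span {x}) := by
  have hxm : x ∈ maximalIdeal R := by rw [hm]; exact Ideal.subset_span (by simp)
  have : Nontrivial (R ⧸ Ideal.span {x}) := by
    apply Ideal.Quotient.nontrivial_iff.2
    intro h
    rw [Ideal.span_singleton_eq_top] at h
    exact hxm h
  exact IsLocalRing.of_surjective' (Ideal.Quotient.mk (Ideal.span {x})) Ideal.Quotient.mk_surjective

lemma prime_span (hdim : ringKrullDim R = 2) (x y : R)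
    (hm : maximalIdeal R = Ideal.span {x, y}) : (Ideal.span {x}).IsPrime := by
  have hl := quot_local x y hm
  have hq := quot_max x y hm
  constructor
  · exact fun h => not_pow_mem hdim x y hm 0 (h ▸ trivial)
  · intro p q hpq
    by_contra hc
    push Not at hc
    rw [← Ideal.Quotient.eq_zero_iff_mem, ← Ideal.Quotient.eq_zero_iff_mem] at hc
    obtain ⟨n, u, hu, eu⟩ := pow_unit_of_principal _ hq _ hc.1
    obtain ⟨n', u', hu', eu'⟩ := pow_unit_of_principal _ hq _ hc.2
    rw [← Ideal.Quotient.eq_zero_iff_mem, map_mul, eu, eu', mul_mul_mul_comm, ← pow_add,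
      IsUnit.mul_left_eq_zero (hu.mul hu'), ← map_pow, Ideal.Quotient.eq_zero_iff_mem] at hpq
    exact not_pow_mem hdim x y hm _ hpq

lemma ufd [IsDomain R] (hdim : ringKrullDim R = 2) (x y : R)
    (hm : maximalIdeal R = Ideal.span {x, y}) : UniqueFactorizationMonoid R := by
  have hl := quot_local x y hm
  have hq := quot_max x y hm
  have hP := prime_span hdim x y hm
  have hpr : (maximalIdeal (R ⧸ Ideal.span {x})).IsPrincipal := ⟨⟨_, hq⟩⟩
  have hpid : IsPrincipalIdealRing (R ⧸ Ideal.span {x}) :=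
    ((tfae_of_isNoetherianRing_of_isLocalRing_of_isDomain (R ⧸ Ideal.span {x})).out 0 4).2 hpr
  have hx0 : x ≠ 0 := by
    rintro rfl
    have hm' : maximalIdeal R = Ideal.span {y, 0} := by rw [hm, Set.pair_comm]
    exact not_pow_mem hdim y 0 hm' 1 (by simp)
  have hxm : x ∈ maximalIdeal R := by rw [hm]; exact Ideal.subset_span (by simp)
  rw [UniqueFactorizationMonoid.iff_exists_prime_mem_of_isPrime]
  intro P hP0 hPP
  by_cases hxP : x ∈ P
  · exact ⟨x, hxP, (Ideal.span_singleton_prime hx0).1 hP⟩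
  obtain ⟨g', hg'⟩ := (hpid.principal (P.map (Ideal.Quotient.mk (Ideal.span {x})))).principal
  have hg'm : g' ∈ P.map (Ideal.Quotient.mk (Ideal.span {x})) := by
    rw [hg']; exact Submodule.mem_span_singleton_self _
  rw [Ideal.mem_map_iff_of_surjective _ Ideal.Quotient.mk_surjective] at hg'm
  obtain ⟨g, hg, rfl⟩ := hg'm
  have hle : P ≤ Ideal.span {g} := by
    apply Submodule.le_of_le_smul_of_le_jacobson_bot (I := maximalIdeal R)
        (IsNoetherian.noetherian _) (IsLocalRing.maximalIdeal_le_jacobson _)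
    intro p hp
    have h1 := Ideal.mem_map_of_mem (Ideal.Quotient.mk (Ideal.span {x})) hp
    rw [hg'] at h1
    obtain ⟨c, hc⟩ := Ideal.mem_span_singleton'.1 h1
    obtain ⟨c, rfl⟩ := Ideal.Quotient.mk_surjective c
    rw [← map_mul, Ideal.Quotient.eq, Ideal.mem_span_singleton'] at hc
    obtain ⟨s, hs⟩ := hc
    have hsP : s ∈ P := by
      have : s * x ∈ P := by rw [hs]; exact P.sub_mem (P.mul_mem_left _ hg) hp
      exact (hPP.mem_or_mem this).resolve_right hxP
    have : p = c * g + x * (-s) := by linear_combination hs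
    rw [this]
    exact Ideal.add_mem _ (Ideal.mem_sup_left (Ideal.mul_mem_left _ _ (Ideal.mem_span_singleton_self _)))
      (Ideal.mem_sup_right (Ideal.mul_mem_mul hxm (P.neg_mem hsP)))
  have heq : P = Ideal.span {g} := le_antisymm hle ((Ideal.span_singleton_le_iff_mem _).2 hg)
  refine ⟨g, hg, ?_⟩
  rw [← Ideal.span_singleton_prime, ← heq]
  · exact hPP
  · rintro rfl
    apply hP0
    rw [heq]; simp
end ufd
end Verma

namespace Verma

section final

lemma bound_exists {A : Type*} [CommRing A] [IsLocalRing A] [IsNoetherianRing A] (L : Ideal A)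
    (k : ℕ) (hk : maximalIdeal A ^ k ≤ L) : ∃ n, Bound L n := by
  by_cases hL : L = ⊤
  · subst hL
    refine ⟨0, fun p => ?_⟩
    by_contra hc
    push Not at hc
    have h1 := p.step ⟨0, hc⟩
    have h2 : ∀ u v : Set.Ici (⊤ : Ideal A), ¬ u < v := by
      intro u v huv
      have h3 : v.1 ≤ u.1 := le_top.trans (Set.mem_Ici.1 u.2)
      exact (not_le_of_gt huv) h3
    exact h2 _ _ h1
  have hmin : maximalIdeal A ∈ L.minimalPrimes := by
    refine ⟨⟨inferInstance, IsLocalRing.le_maximalIdeal hL⟩, ?_⟩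
    rintro Q ⟨hQ, hLQ⟩ -
    exact hQ.le_of_pow_le (hk.trans hLQ)
  have hart := IsLocalRing.quotient_artinian_of_mem_minimalPrimes_of_isLocalRing L hmin
  have hfl : IsFiniteLength (A ⧸ L) (A ⧸ L) :=
    isFiniteLength_iff_isNoetherian_isArtinian.2 ⟨inferInstance, hart⟩
  have hfd : FiniteDimensionalOrder (Submodule (A ⧸ L) (A ⧸ L)) :=
    Module.length_ne_top_iff_finiteDimensionalOrder.1 (Module.length_ne_top_iff.2 hfl)
  let G : Set.Ici L → Submodule (A ⧸ L) (A ⧸ L) := fun P => P.1.map (Ideal.Quotient.mk L)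
  have hG : StrictMono G := by
    intro P Q hPQ
    have h1 : P.1 < Q.1 := hPQ
    refine lt_of_le_not_ge (Ideal.map_mono h1.le) fun h => h1.not_ge ?_
    have h2 : Q.1.map (Ideal.Quotient.mk L) ≤ P.1.map (Ideal.Quotient.mk L) := h
    have h3 := Ideal.comap_mono (f := Ideal.Quotient.mk L) h2
    rw [Ideal.comap_map_of_surjective' _ Ideal.Quotient.mk_surjective,
      Ideal.comap_map_of_surjective' _ Ideal.Quotient.mk_surjective, Ideal.mk_ker,
      sup_eq_left.2 (Set.mem_Ici.1 P.2)] at h3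
    exact le_sup_left.trans h3
  refine ⟨(LTSeries.longestOf (Submodule (A ⧸ L) (A ⧸ L))).length, fun p => ?_⟩
  exact (p.map G hG).length_le_length_longestOf

variable {R : Type*} [CommRing R] {K : Type*} [Field K] (φ : R →+* K)

lemma intclosed_mem (hφ : Function.Injective φ) (hN : Norm φ.range) (I : Ideal R)
    (hIc : I.IsIntegrallyClosedIdeal) (p : K)
    (hp : ∀ V : ValuationSubring K, φ.range ≤ V.toSubring → Cov V (φ '' I) p) :
    ∃ r ∈ I, φ r = p := by
  obtain ⟨r, hr⟩ := hN p (by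
    intro V hV
    obtain ⟨_, ⟨i, hi, rfl⟩, w, hw, rfl⟩ := hp V hV
    exact V.mul_mem _ _ (hV ⟨i, rfl⟩) hw)
  refine ⟨r, ?_, hr⟩
  by_cases hr0 : r = 0
  · rw [hr0]; exact I.zero_mem
  have hp0 : p ≠ 0 := by rw [← hr]; exact (map_ne_zero_iff φ hφ).2 hr0
  let ψ : reesAlgebra I →+* K :=
    (Polynomial.eval₂RingHom φ p⁻¹).comp (reesAlgebra I).val.toRingHom
  let Q0 : Ideal (reesAlgebra I) :=
    RingHom.ker (Polynomial.constantCoeff.comp (reesAlgebra I).val.toRingHom)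
  have htop : Q0.map ψ.rangeRestrict = ⊤ := by
    by_contra hne
    obtain ⟨V, hV, hn⟩ := Ideal.image_subset_nonunits_valuationSubring _ hne
    obtain ⟨_, ⟨i, hi, rfl⟩, w, hw, e⟩ := hp V (by
      rintro _ ⟨s, rfl⟩
      apply hV
      exact ⟨algebraMap R _ s, by
        show Polynomial.eval₂ φ p⁻¹ (Polynomial.C s) = φ s
        simp⟩)
    let P : reesAlgebra I := ⟨Polynomial.monomial 1 i, reesAlgebra.monomial_mem.2 (by simpa using hi)⟩
    have hP : P ∈ Q0 := by
      show (Polynomial.monomial 1 i).coeff 0 = 0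
      simp [Polynomial.coeff_monomial]
    have hψ : ψ P = φ i * p⁻¹ := by
      show Polynomial.eval₂ φ p⁻¹ (Polynomial.monomial 1 i) = _
      simp
    have h1 : ψ P ∈ V.nonunits := hn ⟨_, Ideal.mem_map_of_mem _ hP, rfl⟩
    rw [ValuationSubring.mem_nonunits_iff, hψ] at h1
    have h2 : V.valuation (φ i * p⁻¹ * w) = 1 := by
      have : φ i * p⁻¹ * w = 1 := by
        rw [mul_right_comm, ← e, mul_inv_cancel₀ hp0]
      rw [this, map_one]
    rw [map_mul] at h2
    have h3 : V.valuation w ≤ 1 := (V.valuation_le_one_iff w).2 hw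
    have := mul_lt_one_of_lt_of_le h1 h3
    exact this.ne h2
  have h1 : (1 : ψ.range) ∈ Q0.map ψ.rangeRestrict := htop ▸ Submodule.mem_top
  rw [Ideal.mem_map_iff_of_surjective _ ψ.rangeRestrict_surjective] at h1
  obtain ⟨P, hP, e⟩ := h1
  have hP0 : P.1.coeff 0 = 0 := hP
  have hPc : ∀ i, P.1.coeff i ∈ I ^ i := P.2
  have e' : P.1.eval₂ φ p⁻¹ = 1 := congrArg Subtype.val e
  apply hIc
  refine ⟨P.1.natDegree + 1, Nat.succ_pos _, fun i => - P.1.coeff i,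
    fun i _ _ => neg_mem (hPc i), ?_⟩
  apply hφ
  rw [Polynomial.eval₂_eq_sum_range' φ (n := P.1.natDegree + 1 + 1) (by omega)] at e'
  rw [← Finset.sum_subset (s₁ := Finset.Icc 1 (P.1.natDegree + 1)) (by
    intro i hi; simp at hi ⊢; omega) (by
    intro i hi hi'
    have : i = 0 := by simp at hi hi'; omega
    subst this; simp [hP0])] at e'
  have e2 := congrArg (fun t => p ^ (P.1.natDegree + 1) * t) e'
  simp only [Finset.mul_sum, mul_one] at e2
  rw [map_add, map_sum, map_zero, map_pow, hr, ← e2, ← Finset.sum_add_distrib]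
  apply Finset.sum_eq_zero
  intro i hi
  rw [Finset.mem_Icc] at hi
  rw [map_mul, map_neg, map_pow, hr, pow_sub₀ _ hp0 hi.2, inv_pow]
  ring

lemma norm_range (hφ : Function.Injective φ)
    (hint : ∀ z : K, φ.IsIntegralElem z → z ∈ φ.range) : Norm φ.range := by
  intro z hz
  by_contra hzA
  have : IsIntegrallyClosedIn φ.range K := by
    rw [isIntegrallyClosedIn_iff]
    refine ⟨Subtype.val_injective, ?_⟩
    intro w hw
    let e := RingEquiv.ofBijective φ.rangeRestrict
      ⟨fun a b h => hφ (congrArg Subtype.val h), φ.rangeRestrict_surjective⟩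
    have : w ∈ φ.range := by
      apply hint
      obtain ⟨f, hf, hf'⟩ := hw
      refine ⟨f.map e.symm.toRingHom, hf.map _, ?_⟩
      rw [Polynomial.eval₂_map, ← hf']
      congr 1
      ext c
      obtain ⟨c, rfl⟩ := e.surjective c
      simp
      rfl
    exact ⟨⟨w, this⟩, rfl⟩
  obtain ⟨V, hV, hzV⟩ := Subring.exists_le_valuationSubring_of_isIntegrallyClosedIn hzA
  exact hzV (hz V hV)

def leI (V : ValuationSubring K) (hV : φ.range ≤ V.toSubring) (γ : V.ValueGroup) : Ideal R where
  carrier := {r | V.valuation (φ r) ≤ γ}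
  add_mem' := by
    intro r s hr hs
    simp only [Set.mem_ofPred_eq, map_add] at *
    exact V.valuation.map_add_le hr hs
  zero_mem' := by simp
  smul_mem' := by
    intro c r hr
    simp only [Set.mem_ofPred_eq, smul_eq_mul, map_mul] at *
    exact (mul_le_of_le_one_left' ((V.valuation_le_one_iff _).2 (hV ⟨c, rfl⟩))).trans hr

def ltI (V : ValuationSubring K) (hV : φ.range ≤ V.toSubring) (γ : V.ValueGroup) (h0 : γ ≠ 0) :
    Ideal R where
  carrier := {r | V.valuation (φ r) < γ}
  add_mem' := by
    intro r s hr hs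
    simp only [Set.mem_ofPred_eq, map_add] at *
    exact V.valuation.map_add_lt hr hs
  zero_mem' := by simpa using zero_lt_iff.2 h0
  smul_mem' := by
    intro c r hr
    simp only [Set.mem_ofPred_eq, smul_eq_mul, map_mul] at *
    exact (mul_le_of_le_one_left' ((V.valuation_le_one_iff _).2 (hV ⟨c, rfl⟩))).trans_lt hr

lemma exists_max (V : ValuationSubring K) (hV : φ.range ≤ V.toSubring) (I : Ideal R)
    (hI : I.FG) : ∃ i0 ∈ I, I ≤ leI φ V hV (V.valuation (φ i0)) := by
  induction I, hI using Submodule.fg_induction with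
  | singleton x =>
    refine ⟨x, Submodule.mem_span_singleton_self x, ?_⟩
    rw [Submodule.span_singleton_le_iff_mem]
    exact le_refl (V.valuation (φ x))
  | sup M N _ _ hM hN =>
    obtain ⟨i, hi, h⟩ := hM
    obtain ⟨j, hj, h'⟩ := hN
    rcases le_total (V.valuation (φ i)) (V.valuation (φ j)) with hl | hl
    · exact ⟨j, Submodule.mem_sup_right hj, sup_le (fun z hz => le_trans (h hz : V.valuation (φ z) ≤ _) hl) h'⟩
    · exact ⟨i, Submodule.mem_sup_left hi, sup_le h (fun z hz => le_trans (h' hz : V.valuation (φ z) ≤ _) hl)⟩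

lemma dvd_of_le (V : ValuationSubring K) (a z : K) (h : V.valuation z ≤ V.valuation a) :
    ∃ w ∈ V, z = a * w := by
  by_cases ha : a = 0
  · subst ha
    refine ⟨0, V.zero_mem, ?_⟩
    simpa using h
  · refine ⟨z / a, ?_, by field_simp⟩
    rw [← V.valuation_le_one_iff, map_div₀]
    exact div_le_one_of_le₀ h zero_le

lemma mul_lt_aux {Γ : Type*} [LinearOrderedCommGroupWithZero Γ] {p q r s : Γ} (h : r ≤ s)
    (hs : s ≠ 0) (h' : p < q) : p * r < q * s :=
  (mul_le_mul_right h p).trans_lt (mul_lt_mul_of_pos_right h' (zero_lt_iff.2 hs))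

lemma jr_of (hφ : Function.Injective φ) (I J : Ideal R) (hI : I.FG) (hJ : J.FG) (hI0 : I ≠ ⊥)
    (hJ0 : J ≠ ⊥) (a b : R) (k : ℕ)
    (hjr : (I * J) ^ (k + 1) = (Ideal.span {a} * J ⊔ I * Ideal.span {b}) * (I * J) ^ k)
    (V : ValuationSubring K) (hV : φ.range ≤ V.toSubring) :
    JR (φ '' I) (φ '' J) (φ a) (φ b) V := by
  obtain ⟨i0, hi0, hi⟩ := exists_max φ V hV I hI
  obtain ⟨j0, hj0, hj⟩ := exists_max φ V hV J hJ
  by_cases ha : V.valuation (φ i0) ≤ V.valuation (φ a)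
  · left
    rintro _ ⟨i, hi', rfl⟩
    exact dvd_of_le V _ _ (le_trans (hi hi' : V.valuation (φ i) ≤ _) ha)
  by_cases hb : V.valuation (φ j0) ≤ V.valuation (φ b)
  · right
    rintro _ ⟨j, hj', rfl⟩
    exact dvd_of_le V _ _ (le_trans (hj hj' : V.valuation (φ j) ≤ _) hb)
  exfalso
  rw [not_le] at ha hb
  have hpi : 0 < V.valuation (φ i0) := lt_of_le_of_lt zero_le ha
  have hpj : 0 < V.valuation (φ j0) := lt_of_le_of_lt zero_le hb
  set c := V.valuation (φ i0) * V.valuation (φ j0) with hc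
  have hc0 : c ≠ 0 := mul_ne_zero hpi.ne' hpj.ne'
  have h1 : ∀ k, (I * J) ^ k ≤ leI φ V hV (c ^ k) := by
    intro k
    induction k with
    | zero =>
      intro r _
      show V.valuation (φ r) ≤ c ^ 0
      rw [pow_zero]
      exact (V.valuation_le_one_iff _).2 (hV ⟨r, rfl⟩)
    | succ k ih =>
      have hIJ : I * J ≤ leI φ V hV c := by
        rw [Ideal.mul_le]
        intro i hi' j hj'
        show V.valuation (φ (i * j)) ≤ c
        rw [map_mul, map_mul]
        exact mul_le_mul' (hi hi') (hj hj')
      rw [pow_succ, Ideal.mul_le]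
      intro r hr s hs
      show V.valuation (φ (r * s)) ≤ c ^ (k + 1)
      rw [map_mul, map_mul, pow_succ]
      exact mul_le_mul' (ih hr) (hIJ hs)
  have h2 : Ideal.span {a} * J ⊔ I * Ideal.span {b} ≤ ltI φ V hV c hc0 := by
    apply sup_le
    · rw [Ideal.span_singleton_mul_le_iff]
      intro j hj'
      show V.valuation (φ (a * j)) < c
      rw [map_mul, map_mul]
      exact mul_lt_aux (hj hj') hpj.ne' ha
    · rw [mul_comm, Ideal.span_singleton_mul_le_iff]
      intro i hi'
      show V.valuation (φ (b * i)) < c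
      rw [map_mul, map_mul, hc, mul_comm (V.valuation (φ i0))]
      exact mul_lt_aux (hi hi') hpi.ne' hb
  have h3 : (I * J) ^ (k + 1) ≤ ltI φ V hV (c ^ (k + 1)) (pow_ne_zero _ hc0) := by
    rw [hjr, Ideal.mul_le]
    intro r hr s hs
    show V.valuation (φ (r * s)) < c ^ (k + 1)
    rw [map_mul, map_mul, pow_succ']
    exact mul_lt_aux (h1 k hs) (pow_ne_zero _ hc0) (h2 hr)
  have h4 : V.valuation (φ ((i0 * j0) ^ (k + 1))) < c ^ (k + 1) :=
    h3 (Ideal.pow_mem_pow (Ideal.mul_mem_mul hi0 hj0) _)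
  rw [map_pow, map_pow, map_mul, map_mul] at h4
  exact lt_irrefl _ h4

lemma claim_triv (I J : Set K) (a b : K) (A : Subring K) (hI : ∃ i ∈ I, i ≠ 0) (hJ : ∃ j ∈ J, j ≠ 0)
    (hab : a = 0 ∨ b = 0)
    (hJR : ∀ V : ValuationSubring K, A ≤ V.toSubring → JR I J a b V) : Claim I J a b A := by
  obtain ⟨i1, hi1, hi10⟩ := hI
  obtain ⟨j1, hj1, hj10⟩ := hJ
  intro z hz
  rcases hab with rfl | rfl
  · have h : ∀ V : ValuationSubring K, A ≤ V.toSubring → ∀ j ∈ J, ∃ w ∈ V, j = b * w := by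
      intro V hV
      refine (hJR V hV).resolve_left fun h => ?_
      obtain ⟨w, -, e⟩ := h i1 hi1
      exact hi10 (by simpa using e)
    by_cases hb : b = 0
    · refine ⟨0, 0, ?_, fun V hV => ⟨⟨j1, hj1, 0, V.zero_mem, by simp⟩, ⟨i1, hi1, 0, V.zero_mem, by simp⟩⟩⟩
      obtain ⟨V, hV, -⟩ := exists_val_prime A ⊥
      obtain ⟨w, -, e⟩ := h V hV j1 hj1
      exact absurd (by simpa [hb] using e) hj10
    · refine ⟨z / b, 0, by field_simp; ring, fun V hV => ⟨⟨j1, hj1, 0, V.zero_mem, by simp⟩, ?_⟩⟩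
      obtain ⟨i, hi, j, hj, w, hw, rfl⟩ := hz V hV
      obtain ⟨u, hu, rfl⟩ := h V hV j hj
      exact ⟨i, hi, u * w, V.mul_mem _ _ hu hw, by field_simp⟩
  · have h : ∀ V : ValuationSubring K, A ≤ V.toSubring → ∀ j ∈ I, ∃ w ∈ V, j = a * w := by
      intro V hV
      refine (hJR V hV).resolve_right fun h => ?_
      obtain ⟨w, -, e⟩ := h j1 hj1
      exact hj10 (by simpa using e)
    by_cases hb : a = 0
    · refine ⟨0, 0, ?_, fun V hV => ⟨⟨j1, hj1, 0, V.zero_mem, by simp⟩, ⟨i1, hi1, 0, V.zero_mem, by simp⟩⟩⟩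
      obtain ⟨V, hV, -⟩ := exists_val_prime A ⊥
      obtain ⟨w, -, e⟩ := h V hV i1 hi1
      exact absurd (by simpa [hb] using e) hi10
    · refine ⟨0, z / a, by field_simp; ring, fun V hV => ⟨?_, ⟨i1, hi1, 0, V.zero_mem, by simp⟩⟩⟩
      obtain ⟨i, hi, j, hj, w, hw, rfl⟩ := hz V hV
      obtain ⟨u, hu, rfl⟩ := h V hV i hi
      exact ⟨j, hj, u * w, V.mul_mem _ _ hu hw, by field_simp⟩

end final
end Verma

/-- Verma's theorem: in a two-dimensional regular local ring, joint reductions of pairs of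
`m`-primary integrally closed ideals have joint reduction number zero. -/
theorem stmt_12 (R : Type*) [CommRing R] [IsDomain R] [IsNoetherianRing R] [IsLocalRing R]
    (hdim : ringKrullDim R = 2) (x y : R)
    (hm : maximalIdeal R = Ideal.span {x, y})
    (I J : Ideal R)
    (hI : I.radical = maximalIdeal R) (hJ : J.radical = maximalIdeal R)
    (hIc : I.IsIntegrallyClosedIdeal) (hJc : J.IsIntegrallyClosedIdeal)
    (a b : R) (haI : a ∈ I) (hbJ : b ∈ J)
    (hjr : ∃ k : ℕ, (I * J) ^ (k + 1)
      = (Ideal.span {a} * J ⊔ I * Ideal.span {b}) * (I * J) ^ k) :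
    I * J = Ideal.span {a} * J ⊔ I * Ideal.span {b} := by
  have hufd := Verma.ufd hdim x y hm
  have hic : IsIntegrallyClosed R := inferInstance
  let K := FractionRing R
  let φ : R →+* K := algebraMap R K
  have hφ : Function.Injective φ := IsFractionRing.injective R K
  have hN : Verma.Norm φ.range := by
    apply Verma.norm_range φ hφ
    intro z hz
    obtain ⟨r, hr⟩ := IsIntegrallyClosed.isIntegral_iff.1 (show IsIntegral R z from hz)
    exact ⟨r, hr⟩
  have hm0 : maximalIdeal R ≠ ⊥ := by
    intro h0
    have hy : y ∈ maximalIdeal R := by rw [hm]; exact Ideal.subset_span (by simp)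
    rw [h0, Ideal.mem_bot] at hy
    exact Verma.not_pow_mem hdim x y hm 1 (by simp [hy])
  have hI0 : I ≠ ⊥ := by
    rintro rfl
    exact hm0 (by rw [← hI]; exact Ideal.isRadical_bot.radical)
  have hJ0 : J ≠ ⊥ := by
    rintro rfl
    exact hm0 (by rw [← hJ]; exact Ideal.isRadical_bot.radical)
  obtain ⟨k0, hjr⟩ := hjr
  have hJR := fun V hV => Verma.jr_of φ hφ I J (IsNoetherian.noetherian I)
    (IsNoetherian.noetherian J) hI0 hJ0 a b k0 hjr V hV
  have hclaim : Verma.Claim (φ '' I) (φ '' J) (φ a) (φ b) φ.range := by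
    by_cases hab : φ a = 0 ∨ φ b = 0
    · obtain ⟨i, hi, hi0⟩ := Submodule.exists_mem_ne_zero_of_ne_bot hI0
      obtain ⟨j, hj, hj0⟩ := Submodule.exists_mem_ne_zero_of_ne_bot hJ0
      exact Verma.claim_triv _ _ _ _ _ ⟨φ i, ⟨i, hi, rfl⟩, (map_ne_zero_iff φ hφ).2 hi0⟩
        ⟨φ j, ⟨j, hj, rfl⟩, (map_ne_zero_iff φ hφ).2 hj0⟩ hab hJR
    push Not at hab
    let e := RingEquiv.ofBijective φ.rangeRestrict
      ⟨fun a b h => hφ (congrArg Subtype.val h), φ.rangeRestrict_surjective⟩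
    have hloc : IsLocalRing φ.range := e.isLocalRing
    have hnoe : IsNoetherianRing φ.range := isNoetherianRing_range φ
    have hmm := IsLocalRing.map_maximalIdeal_of_surjective φ.rangeRestrict
      φ.rangeRestrict_surjective
    have hm' : maximalIdeal φ.range = Ideal.span {φ.rangeRestrict x, φ.rangeRestrict y} := by
      rw [← hmm, hm, Ideal.map_span, Set.image_pair]
    have hInt : Verma.Int (φ '' I) (φ '' J) φ.range 1 := by
      rintro _ ⟨i, hi, rfl⟩ _ ⟨j, hj, rfl⟩
      exact ⟨φ.rangeRestrict (i * j), by simp⟩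
    have hrad : (I * J).radical = maximalIdeal R := by
      rw [Ideal.radical_mul, hI, hJ, inf_idem]
    obtain ⟨k, hk⟩ := Ideal.exists_radical_pow_le_of_fg (I * J) (IsNoetherian.noetherian _)
    rw [hrad] at hk
    have hk' : maximalIdeal φ.range ^ k ≤ Verma.Lid (φ '' I) (φ '' J) φ.range 1 := by
      rw [← hmm, ← Ideal.map_pow]
      refine (Ideal.map_mono hk).trans ?_
      rw [Ideal.map_le_iff_le_comap, Ideal.mul_le]
      intro i hi j hj
      exact Ideal.subset_span ⟨φ i, ⟨i, hi, rfl⟩, φ j, ⟨j, hj, rfl⟩, by simp⟩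
    obtain ⟨n, hn⟩ := Verma.bound_exists _ k hk'
    exact Verma.main (φ '' I) (φ '' J) (φ a) (φ b) ⟨a, haI, rfl⟩ ⟨b, hbJ, rfl⟩ hab.1 hab.2 n φ.range _ _ hm' hN 1
      one_ne_zero hInt hn hJR
  apply le_antisymm
  · intro z hz
    obtain ⟨p, q, e, hpq⟩ := hclaim (φ z) (by
      intro V hV
      have : Verma.Cov V {s | ∃ i ∈ I, ∃ j ∈ J, s = φ i * φ j} (φ z) := by
        induction hz using Submodule.mul_induction_on' with
        | mem_mul_mem i hi j hj =>
          exact ⟨φ i * φ j, ⟨i, hi, j, hj, rfl⟩, 1, V.one_mem, by simp⟩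
        | add u _ v _ hu hv => rw [map_add]; exact hu.add hv
      obtain ⟨_, ⟨i, hi, j, hj, rfl⟩, w, hw, e⟩ := this
      exact ⟨φ i, ⟨i, hi, rfl⟩, φ j, ⟨j, hj, rfl⟩, w, hw, e⟩)
    obtain ⟨p, hp, rfl⟩ := Verma.intclosed_mem φ hφ hN I hIc p fun V hV => (hpq V hV).2
    obtain ⟨q, hq, rfl⟩ := Verma.intclosed_mem φ hφ hN J hJc q fun V hV => (hpq V hV).1
    have : z = a * q + p * b := hφ (by rw [e, map_add, map_mul, map_mul]; ring)
    rw [this]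
    exact Ideal.add_mem _
      (Ideal.mem_sup_left (Ideal.mul_mem_mul (Ideal.mem_span_singleton_self a) hq))
      (Ideal.mem_sup_right (Ideal.mul_mem_mul hp (Ideal.mem_span_singleton_self b)))
  · exact sup_le (Ideal.mul_mono_left ((Ideal.span_singleton_le_iff_mem _).2 haI))
      (Ideal.mul_mono_right ((Ideal.span_singleton_le_iff_mem _).2 hbJ))
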